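/- arXiv:cs/0510019 — 9 statements merged into one kernel-verified Lean document; each statement's English description precedes it below -/
import Mathlib

section
/- Let w be a probability mass function on a countable type with base-2 Shannon entropy H(w) = ∑_i −w_i·log₂ w_i satisfying H(w) ≥ 4, and let s be an integer with s ≥ 4·(2^{H(w)} + 1). Then ∑_i w_i·(1 − (1 − w_i)^s) ≥ (1 − 1/e)/H(w). Equivalently: if X, Y₁, …, Y_s are independent random variables each distributed according to w, then the probability that Y_j = X for at least one j is at least (1 − 1/e)/H(w). -/
/-- `s` trials of success probability `p ≥ 1 / s` succeed with probability at least `1 - 1 / e`. -/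
theorem one_sub_inv_exp_le_one_sub_one_sub_pow {p : ℝ} (hp : p ≤ 1) {s : ℕ} (h : 1 ≤ p * s) :
    1 - 1 / Real.exp 1 ≤ 1 - (1 - p) ^ s := by
  have h1 : (1 - p) ^ s ≤ Real.exp (-p) ^ s :=
    pow_le_pow_left₀ (by linarith) (Real.one_sub_le_exp_neg p) s
  have h2 : Real.exp (-p) ^ s ≤ 1 / Real.exp 1 := by
    rw [← Real.exp_nat_mul, one_div, ← Real.exp_neg]
    exact Real.exp_le_exp.2 (by linarith)
  linarith

/-- Pointwise Markov-type bound: the hitting probability of an atom of mass `p` dominates an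
affine function of its surprisal `-logb 2 p`. -/
theorem mul_one_sub_surprisal_le_mul_hit {p L : ℝ} (hp0 : 0 ≤ p) (hp : p ≤ 1) (hL : 0 < L)
    {s : ℕ} (hs : (2 : ℝ) ^ L ≤ s) :
    (1 - 1 / Real.exp 1) * (p - -(p * Real.logb 2 p) / L) ≤ p * (1 - (1 - p) ^ s) := by
  rcases hp0.eq_or_lt with rfl | hpos
  · simp
  have hc : 0 ≤ 1 - 1 / Real.exp 1 := by
    rw [sub_nonneg, div_le_one (Real.exp_pos 1)]
    exact Real.one_le_exp zero_le_one
  have hlog : Real.logb 2 p ≤ 0 := Real.logb_nonpos one_lt_two hp0 hp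
  have hrw : (1 - 1 / Real.exp 1) * (p - -(p * Real.logb 2 p) / L)
      = p * ((1 - 1 / Real.exp 1) * (1 + Real.logb 2 p / L)) := by ring
  rw [hrw]
  refine mul_le_mul_of_nonneg_left ?_ hp0
  rcases le_total (-L) (Real.logb 2 p) with h | h
  · have hp' : (2 : ℝ) ^ (-L) ≤ p := (Real.le_logb_iff_rpow_le one_lt_two hpos).1 h
    have hps : 1 ≤ p * s := by
      calc (1 : ℝ) = 2 ^ (-L) * 2 ^ L := by rw [← Real.rpow_add two_pos]; simp
        _ ≤ p * s := by gcongr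
    refine le_trans (mul_le_of_le_one_right hc ?_) (one_sub_inv_exp_le_one_sub_one_sub_pow hp hps)
    linarith [div_nonpos_of_nonpos_of_nonneg hlog hL.le]
  · have hneg : 1 + Real.logb 2 p / L ≤ 0 := by
      have : Real.logb 2 p / L ≤ -1 := by rw [div_le_iff₀ hL]; linarith
      linarith
    exact (mul_nonpos_of_nonneg_of_nonpos hc hneg).trans
      (sub_nonneg.2 (pow_le_one₀ (by linarith) (by linarith)))


/-- Coupon-collection lemma for guessing a random value: if a pmf `w` on a countable
type has base-2 Shannon entropy `H ≥ 4` and `s ≥ 4·(2^H + 1)`, then `s` independent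
samples from `w` hit a further independent sample from `w` with probability at least
`(1 - 1/e)/H`. -/
theorem entropy_coupon_collection {ι : Type*} [Countable ι] (w : ι → ℝ)
    (hw0 : ∀ i, 0 ≤ w i) (hws : Summable w) (hw1 : ∑' i, w i = 1)
    (hIsum : Summable fun i => -(w i * Real.logb 2 (w i)))
    (H : ℝ) (hH : H = ∑' i, -(w i * Real.logb 2 (w i))) (hH4 : 4 ≤ H)
    (s : ℕ) (hs : 4 * ((2 : ℝ) ^ H + 1) ≤ s) :
    (1 - 1 / Real.exp 1) / H ≤ ∑' i, w i * (1 - (1 - w i) ^ s) := by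
  have hwle : ∀ i, w i ≤ 1 := fun i => hw1 ▸ hws.le_tsum i fun j _ => hw0 j
  have hL : 0 < H + 2 := by linarith
  have hsL : (2 : ℝ) ^ (H + 2) ≤ s := by
    rw [Real.rpow_add two_pos, Real.rpow_two]
    linarith
  have hc : 0 ≤ 1 - 1 / Real.exp 1 := by
    rw [sub_nonneg, div_le_one (Real.exp_pos 1)]
    exact Real.one_le_exp zero_le_one
  have hsum : Summable fun i => w i * (1 - (1 - w i) ^ s) := by
    refine Summable.of_nonneg_of_le (fun i => ?_) (fun i => ?_) hws
    · exact mul_nonneg (hw0 i)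
        (sub_nonneg.2 (pow_le_one₀ (by linarith [hwle i]) (by linarith [hw0 i])))
    · exact mul_le_of_le_one_right (hw0 i)
        (sub_le_self _ (pow_nonneg (by linarith [hwle i]) s))
  have hlower : HasSum
      (fun i => (1 - 1 / Real.exp 1) * (w i - -(w i * Real.logb 2 (w i)) / (H + 2)))
      ((1 - 1 / Real.exp 1) * (1 - H / (H + 2))) :=
    ((hw1 ▸ hws.hasSum).sub ((hH ▸ hIsum.hasSum).div_const (H + 2))).mul_left _
  refine le_trans ?_ (hasSum_le
    (fun i => mul_one_sub_surprisal_le_mul_hit (hw0 i) (hwle i) hL hsL) hlower hsum.hasSum)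
  rw [div_eq_mul_one_div]
  refine mul_le_mul_of_nonneg_left ?_ hc
  rw [one_sub_div hL.ne', div_le_div_iff₀ (by linarith) hL]
  linarith
end

section
/- Let w and w' be probability mass functions on the same countable type, let C ≥ 1 be a real number with w'_i ≥ w_i/C for every index i, suppose the base-2 Shannon entropy H(w) ≥ 4, and let s be an integer with s ≥ 4·C·(2^{H(w)} + 1). Then ∑_i w_i·(1 − (1 − w'_i)^s) ≥ (1 − 1/e)/H(w). Equivalently: if X is distributed according to w and Y₁, …, Y_s are independent samples from w' (independent of X), then the probability that Y_j = X for some j is at least (1 − 1/e)/H(w). -/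
/-- Pointwise form of the coupon-collection bound with threshold probability `2 ^ (-L)`. -/
theorem coupon_hit_prob_lower_bound {p q C L : ℝ} (hp0 : 0 ≤ p) (hp1 : p ≤ 1) (hq0 : 0 ≤ q)
    (hq1 : q ≤ 1) (hC : 0 < C) (hpq : p / C ≤ q) (hL : 0 < L) {s : ℕ}
    (hs : C * (2 : ℝ) ^ L ≤ s) :
    (1 - 1 / Real.exp 1) * (p - -(p * Real.logb 2 p) / L) ≤ p * (1 - (1 - q) ^ s) := by
  have he : 0 ≤ 1 - 1 / Real.exp 1 := by
    rw [sub_nonneg, div_le_one (Real.exp_pos 1)]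
    exact Real.one_le_exp zero_le_one
  have hrhs : 0 ≤ 1 - (1 - q) ^ s :=
    sub_nonneg.2 (pow_le_one₀ (by linarith) (by linarith))
  rcases hp0.eq_or_lt with rfl | hp
  · simp
  have hfactor : p - -(p * Real.logb 2 p) / L = p * (1 + Real.logb 2 p / L) := by ring
  rw [hfactor, mul_left_comm]
  refine mul_le_mul_of_nonneg_left ?_ hp0
  by_cases h : -L ≤ Real.logb 2 p
  · have hlog : Real.logb 2 p / L ≤ 0 :=
      div_nonpos_of_nonpos_of_nonneg (Real.logb_nonpos one_lt_two hp0 hp1) hL.le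
    have hthr : (2 : ℝ) ^ (-L) ≤ p := (Real.le_logb_iff_rpow_le one_lt_two hp).1 h
    have hsq : 1 ≤ s * q :=
      calc (1 : ℝ) = C * (2 : ℝ) ^ L * ((2 : ℝ) ^ (-L) / C) := by
            rw [Real.rpow_neg zero_le_two]
            field_simp
        _ ≤ s * (p / C) := by gcongr
        _ ≤ s * q := by gcongr
    have hpow : (1 - q) ^ s ≤ 1 / Real.exp 1 :=
      calc (1 - q) ^ s ≤ Real.exp (-q) ^ s :=
            pow_le_pow_left₀ (by linarith) (Real.one_sub_le_exp_neg q) s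
        _ = Real.exp (-(s * q)) := by rw [← Real.exp_nat_mul, mul_neg]
        _ ≤ Real.exp (-1) := Real.exp_le_exp.2 (by linarith)
        _ = 1 / Real.exp 1 := by rw [Real.exp_neg, one_div]
    calc (1 - 1 / Real.exp 1) * (1 + Real.logb 2 p / L) ≤ 1 - 1 / Real.exp 1 :=
          mul_le_of_le_one_right he (by linarith)
      _ ≤ 1 - (1 - q) ^ s := by linarith
  · have hlog : Real.logb 2 p / L ≤ -1 := by
      rw [div_le_iff₀ hL]
      linarith
    exact (mul_nonpos_of_nonneg_of_nonpos he (by linarith)).trans hrhs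


/-- Coupon-collection lemma with samples from a comparable distribution: if `w'` is a pmf
with `w'_i ≥ w_i / C` for all `i` (where `C ≥ 1`), the base-2 entropy of `w` is `H ≥ 4`,
and `s ≥ 4·C·(2^H + 1)`, then `s` independent samples from `w'` hit an independent sample
from `w` with probability at least `(1 - 1/e)/H`. -/
theorem entropy_coupon_collection_comparable {ι : Type*} [Countable ι] (w w' : ι → ℝ)
    (hw0 : ∀ i, 0 ≤ w i) (hws : Summable w) (hw1 : ∑' i, w i = 1)
    (hw'0 : ∀ i, 0 ≤ w' i) (hw's : Summable w') (hw'1 : ∑' i, w' i = 1)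
    (C : ℝ) (hC : 1 ≤ C) (hww' : ∀ i, w i / C ≤ w' i)
    (hIsum : Summable fun i => -(w i * Real.logb 2 (w i)))
    (H : ℝ) (hH : H = ∑' i, -(w i * Real.logb 2 (w i))) (hH4 : 4 ≤ H)
    (s : ℕ) (hs : 4 * C * ((2 : ℝ) ^ H + 1) ≤ s) :
    (1 - 1 / Real.exp 1) / H ≤ ∑' i, w i * (1 - (1 - w' i) ^ s) := by
  have hwle (i : ι) : w i ≤ 1 := hw1 ▸ hws.le_tsum i fun j _ => hw0 j
  have hw'le (i : ι) : w' i ≤ 1 := hw'1 ▸ hw's.le_tsum i fun j _ => hw'0 j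
  have hL : 0 < H + 2 := by linarith
  have hs' : C * (2 : ℝ) ^ (H + 2) ≤ s := by
    refine le_trans ?_ hs
    rw [Real.rpow_add two_pos, Real.rpow_two]
    nlinarith
  have hsum : Summable fun i => w i * (1 - (1 - w' i) ^ s) := by
    refine hws.of_nonneg_of_le (fun i => mul_nonneg (hw0 i) ?_)
      fun i => mul_le_of_le_one_right (hw0 i) ?_
    · exact sub_nonneg.2 (pow_le_one₀ (by linarith [hw'le i]) (by linarith [hw'0 i]))
    · exact sub_le_self _ (pow_nonneg (by linarith [hw'le i]) s)
  have hlower : HasSum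
      (fun i => (1 - 1 / Real.exp 1) * (w i - -(w i * Real.logb 2 (w i)) / (H + 2)))
      ((1 - 1 / Real.exp 1) * (1 - H / (H + 2))) :=
    ((hw1 ▸ hws.hasSum).sub ((hH ▸ hIsum.hasSum).div_const (H + 2))).mul_left _
  have he : 0 ≤ 1 - 1 / Real.exp 1 := by
    rw [sub_nonneg, div_le_one (Real.exp_pos 1)]
    exact Real.one_le_exp zero_le_one
  have hH0 : 0 < H := by linarith
  have hinv : 1 / H ≤ 1 - H / (H + 2) := by
    rw [one_sub_div hL.ne', div_le_div_iff₀ hH0 hL]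
    linarith
  calc (1 - 1 / Real.exp 1) / H = (1 - 1 / Real.exp 1) * (1 / H) := by ring
    _ ≤ (1 - 1 / Real.exp 1) * (1 - H / (H + 2)) := mul_le_mul_of_nonneg_left hinv he
    _ ≤ ∑' i, w i * (1 - (1 - w' i) ^ s) :=
      hasSum_le (fun i => coupon_hit_prob_lower_bound (hw0 i) (hwle i) (hw'0 i) (hw'le i)
        (by linarith) (hww' i) hL hs') hlower hsum.hasSum
end

section
/- For every sufficiently large integer m (say m ≥ 16) there exists a finitely supported probability mass function w such that: (a) the base-2 Shannon entropy of w lies between m and m + 2·log₂ m + 2; and (b) for s = ⌈m·2^m⌉, the hitting probability satisfies ∑_i w_i·(1 − (1 − w_i)^s) ≤ (4·log₂ m + 2)/m. One such w assigns probability w₀ = 4·log₂ m / m to a single atom and splits the remaining mass 1 − w₀ equally among N = ⌈m²·2^m⌉ further atoms. -/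
/-- A sum over `ℕ` of a function of the uniform mass function on `{0, …, N - 1}`. -/
lemma tsum_comp_uniform (N : ℕ) (f : ℝ → ℝ) (hf : f 0 = 0) :
    ∑' i : ℕ, f (if i < N then (N : ℝ)⁻¹ else 0) = N * f (N : ℝ)⁻¹ := by
  rw [tsum_eq_sum (s := Finset.range N)]
  · rw [Finset.sum_congr rfl fun i hi => by rw [if_pos (Finset.mem_range.mp hi)]]
    simp
  · intro i hi
    rw [if_neg (by simpa using hi), hf]

/-- Near-tightness of the coupon-collection sample bound: for every `m ≥ 16` there is a
finitely supported pmf whose base-2 entropy lies between `m` and `m + 2·log₂ m + 2`, yet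
`s = m·2^m` independent samples hit a further independent sample with probability at most
`(4·log₂ m + 2)/m`. -/
theorem coupon_collection_tight (m : ℕ) (hm : 16 ≤ m) :
    ∃ w : ℕ → ℝ, (∀ i, 0 ≤ w i) ∧ (Function.support w).Finite ∧ (∑' i, w i) = 1 ∧
      (m : ℝ) ≤ (∑' i, -(w i * Real.logb 2 (w i))) ∧
      (∑' i, -(w i * Real.logb 2 (w i))) ≤ m + 2 * Real.logb 2 m + 2 ∧
      (∑' i, w i * (1 - (1 - w i) ^ (m * 2 ^ m))) ≤ (4 * Real.logb 2 m + 2) / m := by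
  -- The uniform distribution on `m ^ 2 * 2 ^ m` atoms already has all the required properties.
  obtain ⟨N, hN⟩ : ∃ N : ℕ, N = m ^ 2 * 2 ^ m := ⟨_, rfl⟩
  have hm0 : (0 : ℝ) < m := by exact_mod_cast (by omega : 0 < m)
  have hNcast : (N : ℝ) = m ^ 2 * 2 ^ m := by rw [hN]; push_cast; rfl
  have hN0 : (0 : ℝ) < N := by rw [hNcast]; positivity
  have hL : 0 ≤ Real.logb 2 m :=
    Real.logb_nonneg one_lt_two (by exact_mod_cast (by omega : 1 ≤ m))
  have hlog : Real.logb 2 N = 2 * Real.logb 2 m + m := by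
    rw [hNcast, Real.logb_mul (by positivity) (by positivity), Real.logb_pow, Real.logb_pow,
      Real.logb_self_eq_one one_lt_two]
    push_cast
    ring
  have hent : ∑' i : ℕ, -((if i < N then (N : ℝ)⁻¹ else 0) *
      Real.logb 2 (if i < N then (N : ℝ)⁻¹ else 0)) = 2 * Real.logb 2 m + m := by
    rw [tsum_comp_uniform N (fun x => -(x * Real.logb 2 x)) (by simp), Real.logb_inv, hlog]
    field_simp
  refine ⟨fun i => if i < N then (N : ℝ)⁻¹ else 0, fun i => ?_, ?_, ?_, ?_, ?_, ?_⟩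
  · dsimp only
    split_ifs <;> positivity
  · refine (Set.finite_lt_nat N).subset fun i hi => ?_
    by_contra h
    exact hi (if_neg h)
  · rw [tsum_comp_uniform N (fun x => x) rfl]
    exact mul_inv_cancel₀ hN0.ne'
  · rw [hent]; linarith
  · rw [hent]; linarith
  · rw [tsum_comp_uniform N (fun x => x * (1 - (1 - x) ^ (m * 2 ^ m))) (by simp),
      mul_inv_cancel_left₀ hN0.ne']
    have hle : (N : ℝ)⁻¹ ≤ 1 := Nat.cast_inv_le_one N
    have hbern := one_add_mul_le_pow (a := -(N : ℝ)⁻¹) (by linarith) (m * 2 ^ m)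
    rw [← sub_eq_add_neg] at hbern
    have hs : ((m * 2 ^ m : ℕ) : ℝ) * (N : ℝ)⁻¹ = 1 / m := by
      rw [hNcast]
      push_cast
      field_simp
    calc 1 - (1 - (N : ℝ)⁻¹) ^ (m * 2 ^ m) ≤ 1 / m := by linarith
      _ ≤ (4 * Real.logb 2 m + 2) / m := by gcongr; linarith
end

section
/- The integral α = ∫₀^∞ H₂(Φ(x)) dx converges, and its value satisfies 1.29 < α < 1.31 (the numerically computed value is α ≈ 1.303). -/
open MeasureTheory

/-- `Φ(x)`: the upper tail of the standard normal distribution. -/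
noncomputable def stdNormalTail (x : ℝ) : ℝ :=
  (Real.sqrt (2 * Real.pi))⁻¹ * ∫ t in Set.Ioi x, Real.exp (-(t ^ 2) / 2)

/-- Binary entropy function (base 2), with the convention `0 · log₂ 0 = 0`. -/
noncomputable def binEnt (w : ℝ) : ℝ :=
  -(w * Real.logb 2 w) - (1 - w) * Real.logb 2 (1 - w)

open Filter Topology Set

/-! ### Functions changing sign at most once -/

/-- On `S`, once `h` is negative it stays negative. -/
def StaysNeg (S : Set ℝ) (h : ℝ → ℝ) : Prop :=
  ∀ x ∈ S, ∀ y ∈ S, x < y → h x < 0 → h y < 0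

/-- No final piece of `h` on `S` is nonnegative and strictly increasing. -/
def NotEventuallyIncreasing (S : Set ℝ) (h : ℝ → ℝ) : Prop :=
  ∀ x ∈ S, 0 ≤ h x → ¬ StrictMonoOn h (S ∩ Ici x)

lemma StaysNeg.mul_pos {S : Set ℝ} {h w : ℝ → ℝ} (hh : StaysNeg S h) (hw : ∀ x ∈ S, 0 < w x) :
    StaysNeg S (fun x => w x * h x) := by
  intro x hx y hy hxy hneg
  have h1 : h x < 0 := by
    by_contra! hc
    exact absurd hneg (not_lt.2 (mul_nonneg (hw x hx).le hc))
  exact mul_neg_of_pos_of_neg (hw y hy) (hh x hx y hy hxy h1)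

lemma StaysNeg.congr {S : Set ℝ} {h k : ℝ → ℝ} (hh : StaysNeg S h) (hk : ∀ x, k x = h x) :
    StaysNeg S k := by
  rwa [show k = h from funext hk]

lemma exists_hasDerivAt_mul_eq_sub {h h' : ℝ → ℝ} (hd : ∀ x, HasDerivAt h (h' x) x) {x y : ℝ}
    (hxy : x < y) : ∃ ξ ∈ Ioo x y, h' ξ * (y - x) = h y - h x := by
  obtain ⟨ξ, hξ, he⟩ := exists_hasDerivAt_eq_slope h h' hxy
    (fun z _ => (hd z).continuousAt.continuousWithinAt) (fun z _ => hd z)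
  exact ⟨ξ, hξ, by rw [he]; field_simp [sub_ne_zero.2 hxy.ne']⟩

lemma strictMonoOn_of_hasDerivAt_pos {D : Set ℝ} (hD : D.OrdConnected) {h h' : ℝ → ℝ}
    (hd : ∀ x, HasDerivAt h (h' x) x) (hpos : ∀ x ∈ D, (∃ y ∈ D, y < x) → 0 < h' x) :
    StrictMonoOn h D := by
  intro x hx y hy hxy
  obtain ⟨ξ, hξ, he⟩ := exists_hasDerivAt_mul_eq_sub hd hxy
  have := hpos ξ (hD.out hx hy ⟨hξ.1.le, hξ.2.le⟩) ⟨x, hx, hξ.1⟩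
  nlinarith [_root_.mul_pos this (sub_pos.2 hxy)]

/-- Integrating from the left end: if `h 0 ≥ 0` and `h'` stays negative, so does `h`. -/
lemma StaysNeg.of_deriv {S : Set ℝ} {h h' : ℝ → ℝ} (hS : ∀ x ∈ S, Ioc 0 x ⊆ S ∧ 0 < x)
    (hd : ∀ x, HasDerivAt h (h' x) x) (h0 : 0 ≤ h 0) (hh : StaysNeg S h') : StaysNeg S h := by
  intro x hx y hy hxy hneg
  obtain ⟨ξ, hξ, he⟩ := exists_hasDerivAt_mul_eq_sub hd (hS x hx).2
  have hξS : ξ ∈ S := (hS x hx).1 ⟨hξ.1, hξ.2.le⟩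
  have hξn : h' ξ < 0 := by nlinarith [(hS x hx).2]
  obtain ⟨η, hη, he'⟩ := exists_hasDerivAt_mul_eq_sub hd hxy
  have hηS : η ∈ S := (hS y hy).1 ⟨(hS x hx).2.trans hη.1, hη.2.le⟩
  have := hh ξ hξS η hηS (hξ.2.trans hη.1) hξn
  nlinarith

/-- Integrating from the right end: if `-h'` stays negative, so does `h`. -/
lemma StaysNeg.of_neg_deriv {S : Set ℝ} {h h' : ℝ → ℝ} (hS : ∀ x ∈ S, Ioc 0 x ⊆ S ∧ 0 < x)
    (hd : ∀ x, HasDerivAt h (h' x) x) (hend : NotEventuallyIncreasing S h)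
    (hh : StaysNeg S (fun x => -h' x)) : StaysNeg S h := by
  intro x hx y hy hxy hneg
  by_contra! hy0
  obtain ⟨ξ, hξ, he⟩ := exists_hasDerivAt_mul_eq_sub hd hxy
  have hξS : ξ ∈ S := (hS y hy).1 ⟨(hS x hx).2.trans hξ.1, hξ.2.le⟩
  have hξp : -h' ξ < 0 := by nlinarith
  refine hend y hy hy0 (strictMonoOn_of_hasDerivAt_pos ⟨?_⟩ hd ?_)
  · intro a ha b hb z hz
    exact ⟨(hS b hb.1).1 ⟨(hS a ha.1).2.trans_le hz.1, hz.2⟩, ha.2.trans hz.1⟩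
  · intro z hz _
    have := hh ξ hξS z hz.1 (hξ.2.trans_le hz.2) hξp
    linarith

/-- A function vanishing at both ends whose derivative changes sign once is nonnegative. -/
lemma StaysNeg.nonneg_of_deriv {S : Set ℝ} {h h' : ℝ → ℝ} (hS : ∀ x ∈ S, Ioc 0 x ⊆ S ∧ 0 < x)
    (hd : ∀ x, HasDerivAt h (h' x) x) (h0 : 0 ≤ h 0)
    (hend : NotEventuallyIncreasing S (fun x => -h x)) (hh : StaysNeg S h') :
    ∀ x ∈ S, 0 ≤ h x := by
  intro x hx
  by_contra! hneg
  obtain ⟨ξ, hξ, he⟩ := exists_hasDerivAt_mul_eq_sub hd (hS x hx).2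
  have hξS : ξ ∈ S := (hS x hx).1 ⟨hξ.1, hξ.2.le⟩
  have hξn : h' ξ < 0 := by nlinarith [(hS x hx).2]
  refine hend x hx (by linarith)
    (strictMonoOn_of_hasDerivAt_pos (h' := fun x => -h' x) ⟨?_⟩ (fun z => (hd z).neg) ?_)
  · intro a ha b hb z hz
    exact ⟨(hS b hb.1).1 ⟨(hS a ha.1).2.trans_le hz.1, hz.2⟩, ha.2.trans hz.1⟩
  · intro z hz _
    have := hh ξ hξS z hz.1 (hξ.2.trans_le hz.2) hξn
    linarith

lemma NotEventuallyIncreasing.of_tendsto {h : ℝ → ℝ} (hh : Tendsto h atTop (𝓝 0)) :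
    NotEventuallyIncreasing (Ioi 0) h := by
  intro x hx hx0 hmono
  have hx' : (0 : ℝ) < x := hx
  have h1 : h x < h (x + 1) :=
    hmono ⟨hx, mem_Ici.2 le_rfl⟩ ⟨mem_Ioi.2 (by linarith), mem_Ici.2 (by linarith)⟩ (by linarith)
  have h2 : h (x + 1) ≤ 0 := by
    refine ge_of_tendsto hh ?_
    filter_upwards [eventually_ge_atTop (x + 1)] with y hy
    exact hmono.monotoneOn ⟨mem_Ioi.2 (by linarith), mem_Ici.2 (by linarith)⟩
      ⟨mem_Ioi.2 (by linarith), mem_Ici.2 (by linarith)⟩ hy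
  linarith

lemma NotEventuallyIncreasing.of_neg {h : ℝ → ℝ} {T : ℝ} (hT : 0 < T) (hh : h T < 0) :
    NotEventuallyIncreasing (Ioc 0 T) h := by
  intro x hx hx0 hmono
  have : h x ≤ h T := hmono.monotoneOn ⟨hx, mem_Ici.2 le_rfl⟩ ⟨⟨hT, le_rfl⟩, hx.2⟩ hx.2
  linarith

/-! ### The Gaussian weight and the tail function -/

/-- The unnormalised Gaussian weight. -/
noncomputable def gaussWeight (x : ℝ) : ℝ := Real.exp (-(x ^ 2) / 2)

lemma gaussWeight_pos (x : ℝ) : 0 < gaussWeight x := Real.exp_pos _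

lemma gaussWeight_zero : gaussWeight 0 = 1 := by simp [gaussWeight]

lemma hasDerivAt_gaussWeight (x : ℝ) : HasDerivAt gaussWeight (-x * gaussWeight x) x := by
  have h : HasDerivAt (fun x : ℝ => -(x ^ 2) / 2) (-x) x := by
    have := ((hasDerivAt_pow 2 x).neg.div_const 2)
    refine this.congr_deriv ?_
    push_cast
    ring
  exact h.exp.congr_deriv (by rw [gaussWeight]; ring)

lemma continuous_gaussWeight : Continuous gaussWeight := by
  unfold gaussWeight; fun_prop

lemma gaussWeight_eq (x : ℝ) : gaussWeight x = Real.exp (-(1 / 2) * x ^ 2) := by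
  rw [gaussWeight]; ring_nf

lemma integrable_gaussWeight : Integrable gaussWeight := by
  simp only [funext gaussWeight_eq]
  exact integrable_exp_neg_mul_sq (by norm_num)

lemma integrable_sq_mul_gaussWeight : Integrable (fun x => x ^ 2 * gaussWeight x) := by
  have := integrable_rpow_mul_exp_neg_mul_sq (b := 1 / 2) (by norm_num) (s := 2) (by norm_num)
  refine this.congr (Eventually.of_forall fun x => ?_)
  simp [gaussWeight_eq]

lemma tendsto_pow_mul_gaussWeight (n : ℕ) :
    Tendsto (fun x => x ^ n * gaussWeight x) atTop (𝓝 0) := by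
  refine squeeze_zero' ?_ ?_ (Real.tendsto_pow_mul_exp_neg_atTop_nhds_zero n)
  · filter_upwards [eventually_ge_atTop 0] with x hx
    have := gaussWeight_pos x
    positivity
  · filter_upwards [eventually_ge_atTop 2] with x hx
    have : gaussWeight x ≤ Real.exp (-x) := Real.exp_le_exp.2 (by nlinarith)
    gcongr

lemma tendsto_gaussWeight : Tendsto gaussWeight atTop (𝓝 0) := by
  simpa using tendsto_pow_mul_gaussWeight 0

lemma sqrt_two_pi_pos : 0 < √(2 * Real.pi) := Real.sqrt_pos.2 (by positivity)

lemma integral_gaussWeight_Ioi_zero : ∫ x in Ioi 0, gaussWeight x = √(2 * Real.pi) / 2 := by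
  simp only [gaussWeight_eq]
  rw [integral_gaussian_Ioi]
  congr 2
  ring

lemma stdNormalTail_eq (x : ℝ) :
    stdNormalTail x = 1 / 2 - (√(2 * Real.pi))⁻¹ * ∫ t in (0 : ℝ)..x, gaussWeight t := by
  have h := intervalIntegral.integral_interval_add_Ioi (a := 0) (b := x)
    integrable_gaussWeight.integrableOn integrable_gaussWeight.integrableOn
  rw [integral_gaussWeight_Ioi_zero] at h
  have hx : stdNormalTail x = (√(2 * Real.pi))⁻¹ * ∫ t in Ioi x, gaussWeight t := rfl
  have hs := sqrt_two_pi_pos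
  rw [hx, eq_sub_of_add_eq' h]
  field_simp

lemma hasDerivAt_stdNormalTail (x : ℝ) :
    HasDerivAt stdNormalTail (-(gaussWeight x / √(2 * Real.pi))) x := by
  rw [show stdNormalTail = _ from funext stdNormalTail_eq]
  have h := continuous_gaussWeight.integral_hasStrictDerivAt 0 x
  refine ((h.hasDerivAt.const_mul (√(2 * Real.pi))⁻¹).const_sub (1 / 2)).congr_deriv ?_
  ring

lemma stdNormalTail_zero : stdNormalTail 0 = 1 / 2 := by simp [stdNormalTail_eq]

lemma integral_gaussWeight_Ioi (x : ℝ) :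
    ∫ t in Ioi x, gaussWeight t = √(2 * Real.pi) * stdNormalTail x := by
  have hs := sqrt_two_pi_pos
  have hx : stdNormalTail x = (√(2 * Real.pi))⁻¹ * ∫ t in Ioi x, gaussWeight t := rfl
  rw [hx]
  field_simp

lemma tendsto_stdNormalTail : Tendsto stdNormalTail atTop (𝓝 0) := by
  rw [show stdNormalTail = _ from funext stdNormalTail_eq]
  have h := intervalIntegral_tendsto_integral_Ioi (a := 0) (l := atTop)
    integrable_gaussWeight.integrableOn tendsto_id
  rw [integral_gaussWeight_Ioi_zero] at h
  have h2 := (h.const_mul (√(2 * Real.pi))⁻¹).const_sub (1 / 2)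
  have hs := sqrt_two_pi_pos
  rwa [show 1 / 2 - (√(2 * Real.pi))⁻¹ * (√(2 * Real.pi) / 2) = 0 by field_simp; norm_num] at h2

lemma stdNormalTail_strictAnti : StrictAnti stdNormalTail := by
  refine strictAnti_of_hasDerivAt_neg hasDerivAt_stdNormalTail fun x => ?_
  have := gaussWeight_pos x
  have := sqrt_two_pi_pos
  simp only [Left.neg_neg_iff]
  positivity

lemma stdNormalTail_pos (x : ℝ) : 0 < stdNormalTail x := by
  have h1 := stdNormalTail_strictAnti (show x < x + 1 by linarith)
  have h2 : 0 ≤ stdNormalTail (x + 1) := stdNormalTail_strictAnti.antitone.le_of_tendsto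
    tendsto_stdNormalTail _
  linarith

lemma stdNormalTail_neg (x : ℝ) : stdNormalTail (-x) = 1 - stdNormalTail x := by
  have h : ∫ t in (0 : ℝ)..(-x), gaussWeight t = -∫ t in (0 : ℝ)..x, gaussWeight t := by
    have := intervalIntegral.integral_comp_neg (a := 0) (b := x) gaussWeight
    rw [show (fun x => gaussWeight (-x)) = gaussWeight from funext fun x => by
      simp [gaussWeight]] at this
    rw [this, neg_zero, intervalIntegral.integral_symm]
  rw [stdNormalTail_eq, stdNormalTail_eq, h]
  ring

lemma stdNormalTail_lt_one (x : ℝ) : stdNormalTail x < 1 := by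
  have := stdNormalTail_pos (-x)
  rw [stdNormalTail_neg] at this
  linarith

/-! ### Comparing the entropy with a Gaussian times a quadratic polynomial -/

lemma binEnt_eq (w : ℝ) : binEnt w = Real.binEntropy w / Real.log 2 := by
  rw [binEnt, Real.binEntropy_eq_negMulLog_add_negMulLog_one_sub, Real.negMulLog, Real.negMulLog,
    Real.logb, Real.logb]
  ring

lemma log_two_pos : 0 < Real.log 2 := Real.log_pos (by norm_num)

/-- `e^{-x²/2} (1 + a x²)`. -/
noncomputable def gaussPoly (a x : ℝ) : ℝ := gaussWeight x * (1 + a * x ^ 2)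

/-- `binEnt (stdNormalTail x) - gaussPoly a x`. -/
noncomputable def entropyGap (a x : ℝ) : ℝ := binEnt (stdNormalTail x) - gaussPoly a x

/-- The derivative of `entropyGap a`, divided by the Gaussian density. -/
noncomputable def logOddsGap (a x : ℝ) : ℝ :=
  √(2 * Real.pi) * ((1 - 2 * a) * x + a * x ^ 3) -
    (Real.log (1 - stdNormalTail x) - Real.log (stdNormalTail x)) / Real.log 2

/-- `1 - 2 a + 3 a x²`, a multiple of the derivative of the polynomial in `logOddsGap`. -/
def slopePoly (a x : ℝ) : ℝ := 1 - 2 * a + 3 * a * x ^ 2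

/-- A function with the sign of the derivative of `logOddsGap a`. -/
noncomputable def varianceGap (a x : ℝ) : ℝ :=
  stdNormalTail x * (1 - stdNormalTail x) -
    gaussWeight x / (√(2 * Real.pi) * (√(2 * Real.pi) * Real.log 2) * slopePoly a x)

/-- The derivative of `varianceGap a`, divided by the Gaussian density. -/
noncomputable def centralGap (a x : ℝ) : ℝ :=
  x * (1 + 4 * a + 3 * a * x ^ 2) / (√(2 * Real.pi) * Real.log 2 * slopePoly a x ^ 2) -
    (1 - 2 * stdNormalTail x)

/-- The derivative of `centralGap a` has the sign of `curvature a - 2 log 2`. -/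
noncomputable def curvature (a x : ℝ) : ℝ :=
  ((1 - 2 * a) * (1 + 4 * a) - 54 * a ^ 2 * x ^ 2 - 9 * a ^ 2 * x ^ 4) /
    (slopePoly a x ^ 3 * gaussWeight x)

/-- The derivative of `curvature a` has the sign of this polynomial in `y = x²`. -/
def curvaturePoly (a y : ℝ) : ℝ :=
  -((108 * a ^ 2 + 36 * a ^ 2 * y) * (1 - 2 * a + 3 * a * y)) +
    ((1 - 2 * a) * (1 + 4 * a) - 54 * a ^ 2 * y - 9 * a ^ 2 * y ^ 2) * (1 - 20 * a + 3 * a * y)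

lemma slopePoly_pos {a : ℝ} (h0 : 0 ≤ a) (h1 : a < 1 / 2) (x : ℝ) : 0 < slopePoly a x := by
  have : 0 ≤ 3 * a * x ^ 2 := by positivity
  unfold slopePoly
  linarith

lemma hasDerivAt_slopePoly (a x : ℝ) : HasDerivAt (slopePoly a) (6 * a * x) x := by
  refine (((hasDerivAt_pow 2 x).const_mul (3 * a)).const_add (1 - 2 * a)).congr_deriv ?_
  push_cast
  ring

lemma hasDerivAt_curvature {a : ℝ} (h0 : 0 ≤ a) (h1 : a < 1 / 2) (x : ℝ) :
    HasDerivAt (curvature a)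
      (x / (slopePoly a x ^ 4 * gaussWeight x) * curvaturePoly a (x ^ 2)) x := by
  have hq := slopePoly_pos h0 h1 x
  have hE := gaussWeight_pos x
  have hn : HasDerivAt
      (fun x => (1 - 2 * a) * (1 + 4 * a) - 54 * a ^ 2 * x ^ 2 - 9 * a ^ 2 * x ^ 4)
      (-(108 * a ^ 2 * x) - 36 * a ^ 2 * x ^ 3) x := by
    refine ((((hasDerivAt_pow 2 x).const_mul (54 * a ^ 2)).const_sub
      ((1 - 2 * a) * (1 + 4 * a))).sub ((hasDerivAt_pow 4 x).const_mul (9 * a ^ 2))).congr_deriv ?_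
    push_cast
    ring
  have hden := ((hasDerivAt_slopePoly a x).pow 3).mul (hasDerivAt_gaussWeight x)
  refine (hn.div hden (by simp only [Pi.mul_apply, Pi.pow_apply]; positivity)).congr_deriv ?_
  simp only [Pi.mul_apply, Pi.pow_apply]
  field_simp
  unfold curvaturePoly slopePoly
  push_cast
  ring

lemma hasDerivAt_centralGap {a : ℝ} (h0 : 0 ≤ a) (h1 : a < 1 / 2) (x : ℝ) :
    HasDerivAt (centralGap a)
      (gaussWeight x / (√(2 * Real.pi) * Real.log 2) * (curvature a x - 2 * Real.log 2)) x := by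
  have hq := slopePoly_pos h0 h1 x
  have hE := gaussWeight_pos x
  have hs := sqrt_two_pi_pos
  have hl := log_two_pos
  have hn : HasDerivAt (fun x => x * (1 + 4 * a + 3 * a * x ^ 2))
      (1 + 4 * a + 9 * a * x ^ 2) x := by
    refine ((hasDerivAt_id x).mul
      (((hasDerivAt_pow 2 x).const_mul (3 * a)).const_add (1 + 4 * a))).congr_deriv ?_
    simp only [id]
    push_cast
    ring
  have hden := ((hasDerivAt_slopePoly a x).pow 2).const_mul (√(2 * Real.pi) * Real.log 2)
  have hu := ((hasDerivAt_stdNormalTail x).const_mul 2).const_sub 1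
  refine ((hn.div hden (by simp only [Pi.pow_apply]; positivity)).sub hu).congr_deriv ?_
  simp only [Pi.pow_apply]
  unfold curvature
  field_simp
  unfold slopePoly
  push_cast
  ring

lemma hasDerivAt_varianceGap {a : ℝ} (h0 : 0 ≤ a) (h1 : a < 1 / 2) (x : ℝ) :
    HasDerivAt (varianceGap a) (gaussWeight x / √(2 * Real.pi) * centralGap a x) x := by
  have hq := slopePoly_pos h0 h1 x
  have hE := gaussWeight_pos x
  have hs := sqrt_two_pi_pos
  have hl := log_two_pos
  have hu := hasDerivAt_stdNormalTail x
  have hden := (hasDerivAt_slopePoly a x).const_mul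
    (√(2 * Real.pi) * (√(2 * Real.pi) * Real.log 2))
  refine ((hu.mul (hu.const_sub 1)).sub ((hasDerivAt_gaussWeight x).div hden
    (by positivity))).congr_deriv ?_
  unfold centralGap
  field_simp
  unfold slopePoly
  ring

lemma hasDerivAt_logOddsGap {a : ℝ} (h0 : 0 ≤ a) (h1 : a < 1 / 2) (x : ℝ) :
    HasDerivAt (logOddsGap a) (√(2 * Real.pi) * slopePoly a x /
      (stdNormalTail x * (1 - stdNormalTail x)) * varianceGap a x) x := by
  have hq := slopePoly_pos h0 h1 x
  have hs := sqrt_two_pi_pos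
  have hl := log_two_pos
  have hu := hasDerivAt_stdNormalTail x
  have hp := stdNormalTail_pos x
  have hp1 := sub_pos.2 (stdNormalTail_lt_one x)
  have hpoly : HasDerivAt (fun x => √(2 * Real.pi) * ((1 - 2 * a) * x + a * x ^ 3))
      (√(2 * Real.pi) * slopePoly a x) x := by
    refine ((((hasDerivAt_id x).const_mul (1 - 2 * a)).add
      ((hasDerivAt_pow 3 x).const_mul a)).const_mul √(2 * Real.pi)).congr_deriv ?_
    unfold slopePoly
    push_cast
    ring
  refine (hpoly.sub ((((hu.const_sub 1).log hp1.ne').sub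
    (hu.log hp.ne')).div_const (Real.log 2))).congr_deriv ?_
  unfold varianceGap
  field_simp
  ring

lemma hasDerivAt_entropyGap (a x : ℝ) :
    HasDerivAt (entropyGap a) (gaussWeight x / √(2 * Real.pi) * logOddsGap a x) x := by
  have hs := sqrt_two_pi_pos
  have hl := log_two_pos
  have hu := hasDerivAt_stdNormalTail x
  have hH := ((Real.hasDerivAt_binEntropy (stdNormalTail_pos x).ne'
    (stdNormalTail_lt_one x).ne).comp x hu).div_const (Real.log 2)
  have hG := (hasDerivAt_gaussWeight x).mul
    (((hasDerivAt_pow 2 x).const_mul a).const_add 1)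
  have h := hH.sub hG
  have he : entropyGap a = (fun x => (Real.binEntropy ∘ stdNormalTail) x / Real.log 2) -
      gaussWeight * fun x => 1 + a * x ^ 2 := by
    ext x
    simp [entropyGap, binEnt_eq, gaussPoly]
  rw [he]
  refine h.congr_deriv ?_
  unfold logOddsGap
  field_simp
  push_cast
  ring

lemma entropyGap_zero (a : ℝ) : entropyGap a 0 = 0 := by
  have hl := log_two_pos
  simp [entropyGap, binEnt_eq, gaussPoly, stdNormalTail_zero, gaussWeight_zero,
    show (1 / 2 : ℝ) = 2⁻¹ by norm_num, hl.ne']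

lemma logOddsGap_zero (a : ℝ) : logOddsGap a 0 = 0 := by
  rw [logOddsGap, stdNormalTail_zero]
  norm_num

lemma centralGap_zero (a : ℝ) : centralGap a 0 = 0 := by
  rw [centralGap, stdNormalTail_zero]
  norm_num

lemma tendsto_gaussPoly (a : ℝ) : Tendsto (gaussPoly a) atTop (𝓝 0) := by
  have h := tendsto_gaussWeight.add ((tendsto_pow_mul_gaussWeight 2).const_mul a)
  simp only [mul_zero, add_zero] at h
  refine h.congr fun x => ?_
  rw [gaussPoly]
  ring

lemma tendsto_entropyGap (a : ℝ) : Tendsto (entropyGap a) atTop (𝓝 0) := by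
  have h := (Real.binEntropy_continuous.tendsto 0).comp tendsto_stdNormalTail
  rw [Real.binEntropy_zero] at h
  have h2 := (h.div_const (Real.log 2)).sub (tendsto_gaussPoly a)
  simp only [zero_div, sub_zero] at h2
  refine h2.congr fun x => ?_
  simp [entropyGap, binEnt_eq]

lemma tendsto_varianceGap {a : ℝ} (h0 : 0 ≤ a) (h1 : a < 1 / 2) :
    Tendsto (varianceGap a) atTop (𝓝 0) := by
  have hs := sqrt_two_pi_pos
  have hl := log_two_pos
  have hA : 0 < 1 - 2 * a := by linarith
  have h2 : Tendsto (fun x => gaussWeight x /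
      (√(2 * Real.pi) * (√(2 * Real.pi) * Real.log 2) * slopePoly a x)) atTop (𝓝 0) := by
    have h3 := tendsto_gaussWeight.div_const
      (√(2 * Real.pi) * (√(2 * Real.pi) * Real.log 2) * (1 - 2 * a))
    rw [zero_div] at h3
    refine squeeze_zero (fun x => ?_) (fun x => ?_) h3
    · have := gaussWeight_pos x
      have := slopePoly_pos h0 h1 x
      positivity
    · have := gaussWeight_pos x
      have : 1 - 2 * a ≤ slopePoly a x := by
        have : 0 ≤ 3 * a * x ^ 2 := by positivity
        unfold slopePoly
        linarith
      gcongr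
  have h4 := (tendsto_stdNormalTail.mul (tendsto_stdNormalTail.const_sub 1)).sub h2
  rwa [zero_mul, sub_zero] at h4

section Chains

variable {S : Set ℝ} {a : ℝ}

lemma entropyGap_nonneg_of_curvature (hS : ∀ x ∈ S, Ioc 0 x ⊆ S ∧ 0 < x)
    (h0 : 0 ≤ a) (h1 : a < 1 / 2)
    (hcurv : StaysNeg S (fun x => 2 * Real.log 2 - curvature a x))
    (hvar : NotEventuallyIncreasing S (varianceGap a))
    (hgap : NotEventuallyIncreasing S (fun x => -entropyGap a x)) :
    ∀ x ∈ S, 0 ≤ entropyGap a x := by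
  have hs := sqrt_two_pi_pos
  have hl := log_two_pos
  have hw : ∀ x ∈ S, 0 < gaussWeight x / √(2 * Real.pi) := fun x _ =>
    div_pos (gaussWeight_pos x) hs
  have hn' : StaysNeg S (fun x => -(gaussWeight x / (√(2 * Real.pi) * Real.log 2) *
      (curvature a x - 2 * Real.log 2))) :=
    (hcurv.mul_pos (w := fun x => gaussWeight x / (√(2 * Real.pi) * Real.log 2))
      fun x _ => div_pos (gaussWeight_pos x) (mul_pos hs hl)).congr fun x => by ring
  have hn : StaysNeg S (fun x => -centralGap a x) :=
    StaysNeg.of_deriv hS (fun x => (hasDerivAt_centralGap h0 h1 x).neg)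
      (by simp [centralGap_zero]) hn'
  have hm : StaysNeg S (varianceGap a) :=
    StaysNeg.of_neg_deriv hS (hasDerivAt_varianceGap h0 h1) hvar
      ((hn.mul_pos hw).congr fun x => by ring)
  have hk : StaysNeg S (logOddsGap a) :=
    StaysNeg.of_deriv hS (hasDerivAt_logOddsGap h0 h1) (logOddsGap_zero a).ge
      (hm.mul_pos fun x _ => div_pos (mul_pos hs (slopePoly_pos h0 h1 x))
        (mul_pos (stdNormalTail_pos x) (sub_pos.2 (stdNormalTail_lt_one x))))
  exact StaysNeg.nonneg_of_deriv hS (hasDerivAt_entropyGap a) (entropyGap_zero a).ge hgap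
    (hk.mul_pos hw)

lemma entropyGap_nonpos_of_curvature (hS : ∀ x ∈ S, Ioc 0 x ⊆ S ∧ 0 < x)
    (h0 : 0 ≤ a) (h1 : a < 1 / 2)
    (hcurv : StaysNeg S (fun x => curvature a x - 2 * Real.log 2))
    (hvar : NotEventuallyIncreasing S (fun x => -varianceGap a x))
    (hgap : NotEventuallyIncreasing S (entropyGap a)) :
    ∀ x ∈ S, entropyGap a x ≤ 0 := by
  have hs := sqrt_two_pi_pos
  have hl := log_two_pos
  have hw : ∀ x ∈ S, 0 < gaussWeight x / √(2 * Real.pi) := fun x _ =>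
    div_pos (gaussWeight_pos x) hs
  have hn : StaysNeg S (centralGap a) :=
    StaysNeg.of_deriv hS (hasDerivAt_centralGap h0 h1) (centralGap_zero a).ge
      (hcurv.mul_pos fun x _ => div_pos (gaussWeight_pos x) (mul_pos hs hl))
  have hm : StaysNeg S (fun x => -varianceGap a x) :=
    StaysNeg.of_neg_deriv hS (fun x => (hasDerivAt_varianceGap h0 h1 x).neg) hvar
      ((hn.mul_pos hw).congr fun x => by ring)
  have hk : StaysNeg S (fun x => -logOddsGap a x) :=
    StaysNeg.of_deriv hS (fun x => (hasDerivAt_logOddsGap h0 h1 x).neg)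
      (by simp [logOddsGap_zero])
      ((hm.mul_pos (w := fun x => √(2 * Real.pi) * slopePoly a x /
          (stdNormalTail x * (1 - stdNormalTail x)))
        fun x _ => div_pos (mul_pos hs (slopePoly_pos h0 h1 x))
        (mul_pos (stdNormalTail_pos x) (sub_pos.2 (stdNormalTail_lt_one x)))).congr
          fun x => by ring)
  intro x hx
  have := StaysNeg.nonneg_of_deriv hS (h := fun x => -entropyGap a x)
    (fun x => (hasDerivAt_entropyGap a x).neg)
    (by simp [entropyGap_zero]) (by simpa using hgap)
    ((hk.mul_pos hw).congr fun x => by ring) x hx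
  linarith

end Chains

lemma Ioc_subset_Ioi_zero (x : ℝ) (hx : x ∈ Ioi (0 : ℝ)) : Ioc 0 x ⊆ Ioi 0 ∧ 0 < x :=
  ⟨fun _ hy => hy.1, hx⟩

lemma Ioc_subset_Ioc_zero (T x : ℝ) (hx : x ∈ Ioc 0 T) : Ioc 0 x ⊆ Ioc 0 T ∧ 0 < x :=
  ⟨fun _ hy => ⟨hy.1, hy.2.trans hx.2⟩, hx.1⟩

lemma gaussWeight_le_entropy {x : ℝ} (hx : 0 < x) : gaussWeight x ≤ binEnt (stdNormalTail x) := by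
  have h1 : StaysNeg (Ioi 0) (fun x => 2 * Real.log 2 - curvature 0 x) := by
    have hc : ∀ x, curvature 0 x = (gaussWeight x)⁻¹ := fun x => by
      simp [curvature, slopePoly]
    intro x hx y hy hxy hneg
    simp only [hc] at hneg ⊢
    have : (gaussWeight x)⁻¹ ≤ (gaussWeight y)⁻¹ := by
      refine inv_anti₀ (gaussWeight_pos y) (Real.exp_le_exp.2 ?_)
      have : (0 : ℝ) < x := hx
      nlinarith
    linarith
  have h := entropyGap_nonneg_of_curvature Ioc_subset_Ioi_zero le_rfl (by norm_num) h1
    (.of_tendsto (tendsto_varianceGap le_rfl (by norm_num)))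
    (.of_tendsto (by simpa using (tendsto_entropyGap 0).neg)) x hx
  simpa [entropyGap, gaussPoly] using h

lemma entropy_le_gaussPoly {x : ℝ} (hx : 0 < x) :
    binEnt (stdNormalTail x) ≤ gaussPoly 0.045 x := by
  have h1 : StaysNeg (Ioi 0) (fun x => curvature 0.045 x - 2 * Real.log 2) := by
    intro x hx y hy hxy hneg
    obtain ⟨ξ, hξ, he⟩ := exists_hasDerivAt_mul_eq_sub
      (hasDerivAt_curvature (a := 0.045) (by norm_num) (by norm_num)) hxy
    have hx0 : (0 : ℝ) < x := hx
    have h2 : curvaturePoly 0.045 (ξ ^ 2) < 0 := by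
      have hy : 0 ≤ ξ ^ 2 := sq_nonneg ξ
      generalize ξ ^ 2 = y at hy
      unfold curvaturePoly
      nlinarith [sq_nonneg (y - 0.7), mul_nonneg hy (sq_nonneg y)]
    have h3 : 0 < ξ / (slopePoly 0.045 ξ ^ 4 * gaussWeight ξ) :=
      div_pos (hx0.trans hξ.1) (mul_pos (pow_pos (slopePoly_pos (by norm_num) (by norm_num) ξ) 4)
        (gaussWeight_pos ξ))
    have := mul_neg_of_pos_of_neg h3 h2
    nlinarith
  have h := entropyGap_nonpos_of_curvature Ioc_subset_Ioi_zero (by norm_num) (by norm_num) h1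
    (.of_tendsto (by simpa using (tendsto_varianceGap (a := 0.045) (by norm_num)
      (by norm_num)).neg)) (.of_tendsto (tendsto_entropyGap _)) x hx
  simpa [entropyGap] using h

/-! ### Rational bounds for the tail and the comparison on a bounded interval -/

lemma nonneg_of_deriv_nonpos_of_tendsto {h h' : ℝ → ℝ} (hd : ∀ x, 0 < x → HasDerivAt h (h' x) x)
    (hneg : ∀ x, 0 < x → h' x ≤ 0) (hlim : Tendsto h atTop (𝓝 0)) {x : ℝ} (hx : 0 < x) :
    0 ≤ h x := by
  have hanti : AntitoneOn h (Ioi 0) := by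
    refine antitoneOn_of_deriv_nonpos (convex_Ioi 0)
      (fun y hy => (hd y hy).continuousAt.continuousWithinAt) ?_ ?_
    · intro y hy
      rw [interior_Ioi] at hy
      exact (hd y hy).differentiableAt.differentiableWithinAt
    · intro y hy
      rw [interior_Ioi] at hy
      rw [(hd y hy).deriv]
      exact hneg y hy
  refine le_of_tendsto hlim ?_
  filter_upwards [eventually_ge_atTop x] with y hy
  exact hanti hx (mem_Ioi.2 (hx.trans_le hy)) hy

lemma tendsto_gaussWeight_mul {r : ℝ → ℝ} (h0 : ∀ x, 1 ≤ x → 0 ≤ r x)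
    (h1 : ∀ x, 1 ≤ x → r x ≤ 1) : Tendsto (fun x => gaussWeight x * r x) atTop (𝓝 0) := by
  refine squeeze_zero' ?_ ?_ tendsto_gaussWeight
  · filter_upwards [eventually_ge_atTop 1] with x hx
    exact mul_nonneg (gaussWeight_pos x).le (h0 x hx)
  · filter_upwards [eventually_ge_atTop 1] with x hx
    exact mul_le_of_le_one_right (gaussWeight_pos x).le (h1 x hx)

lemma hasDerivAt_tail_sub {r : ℝ → ℝ} {r' x : ℝ} (hr : HasDerivAt r r' x) :
    HasDerivAt (fun x => gaussWeight x * r x - √(2 * Real.pi) * stdNormalTail x)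
      (gaussWeight x * (r' - x * r x + 1)) x := by
  have hs := sqrt_two_pi_pos
  refine (((hasDerivAt_gaussWeight x).mul hr).sub
    ((hasDerivAt_stdNormalTail x).const_mul √(2 * Real.pi))).congr_deriv ?_
  field_simp
  ring

lemma stdNormalTail_le_mills {x : ℝ} (hx : 0 < x) :
    √(2 * Real.pi) * stdNormalTail x ≤ gaussWeight x * ((x ^ 2 + 2) / (x ^ 3 + 3 * x)) := by
  have hr : ∀ x : ℝ, 0 < x → HasDerivAt (fun x => (x ^ 2 + 2) / (x ^ 3 + 3 * x))
      ((2 * x * (x ^ 3 + 3 * x) - (x ^ 2 + 2) * (3 * x ^ 2 + 3)) / (x ^ 3 + 3 * x) ^ 2) x := by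
    intro x hx
    refine (((hasDerivAt_pow 2 x).add_const 2).div ((hasDerivAt_pow 3 x).add
      ((hasDerivAt_id x).const_mul 3)) (by simp only [Pi.add_apply, id]; positivity)).congr_deriv ?_
    simp only [Pi.add_apply, id]
    push_cast
    ring
  have hlim := (tendsto_gaussWeight_mul (r := fun x => (x ^ 2 + 2) / (x ^ 3 + 3 * x))
    (fun x hx => by positivity) (fun x hx => by
      rw [div_le_one (by positivity)]
      nlinarith [mul_nonneg (sub_nonneg.2 hx) (sq_nonneg x)])).sub
    (tendsto_stdNormalTail.const_mul √(2 * Real.pi))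
  rw [mul_zero, sub_zero] at hlim
  have := nonneg_of_deriv_nonpos_of_tendsto (fun x hx => hasDerivAt_tail_sub (hr x hx)) ?_ hlim hx
  · linarith
  · intro x hx
    refine mul_nonpos_of_nonneg_of_nonpos (gaussWeight_pos x).le ?_
    have : (2 * x * (x ^ 3 + 3 * x) - (x ^ 2 + 2) * (3 * x ^ 2 + 3)) / (x ^ 3 + 3 * x) ^ 2 -
        x * ((x ^ 2 + 2) / (x ^ 3 + 3 * x)) + 1 = -(6 / (x ^ 3 + 3 * x) ^ 2) := by
      field_simp
      ring
    rw [this, neg_nonpos]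
    positivity

lemma mills_le_stdNormalTail {x : ℝ} (hx : 0 < x) :
    gaussWeight x * ((x ^ 3 + 5 * x) / (x ^ 4 + 6 * x ^ 2 + 3)) ≤
      √(2 * Real.pi) * stdNormalTail x := by
  have hr : ∀ x : ℝ, 0 < x → HasDerivAt (fun x => (x ^ 3 + 5 * x) / (x ^ 4 + 6 * x ^ 2 + 3))
      (((3 * x ^ 2 + 5) * (x ^ 4 + 6 * x ^ 2 + 3) - (x ^ 3 + 5 * x) * (4 * x ^ 3 + 12 * x)) /
        (x ^ 4 + 6 * x ^ 2 + 3) ^ 2) x := by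
    intro x hx
    refine (((hasDerivAt_pow 3 x).add ((hasDerivAt_id x).const_mul 5)).div
      (((hasDerivAt_pow 4 x).add ((hasDerivAt_pow 2 x).const_mul 6)).add_const 3)
      (by simp only [Pi.add_apply]; positivity)).congr_deriv ?_
    simp only [Pi.add_apply, id]
    push_cast
    ring
  have hlim := (tendsto_gaussWeight_mul
    (r := fun x => (x ^ 3 + 5 * x) / (x ^ 4 + 6 * x ^ 2 + 3))
    (fun x hx => by positivity) (fun x hx => by
      rw [div_le_one (by positivity)]
      nlinarith [mul_nonneg (sub_nonneg.2 hx) (pow_nonneg (zero_le_one.trans hx) 3),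
        sq_nonneg (x - 1)])).sub
    (tendsto_stdNormalTail.const_mul √(2 * Real.pi))
  rw [mul_zero, sub_zero] at hlim
  have := nonneg_of_deriv_nonpos_of_tendsto
    (fun x hx => (hasDerivAt_tail_sub (hr x hx)).neg) ?_
    (by have := hlim.neg; rw [neg_zero] at this; exact this) hx
  · simp only [Pi.neg_apply] at this
    linarith
  · intro x hx
    rw [neg_nonpos]
    refine mul_nonneg (gaussWeight_pos x).le ?_
    have : ((3 * x ^ 2 + 5) * (x ^ 4 + 6 * x ^ 2 + 3) - (x ^ 3 + 5 * x) * (4 * x ^ 3 + 12 * x)) /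
        (x ^ 4 + 6 * x ^ 2 + 3) ^ 2 - x * ((x ^ 3 + 5 * x) / (x ^ 4 + 6 * x ^ 2 + 3)) + 1 =
        24 / (x ^ 4 + 6 * x ^ 2 + 3) ^ 2 := by
      field_simp
      ring
    rw [this]
    positivity

lemma sqrt_two_pi_gt : 2.5066 < √(2 * Real.pi) := by
  refine Real.lt_sqrt_of_sq_lt ?_
  have := Real.pi_gt_d6
  norm_num at *
  linarith

lemma sqrt_two_pi_lt : √(2 * Real.pi) < 2.50663 := by
  rw [Real.sqrt_lt' (by norm_num)]
  have := Real.pi_lt_d6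
  norm_num at *
  linarith

lemma exp_two_eq : Real.exp 2 = Real.exp 1 ^ 2 := by
  rw [← Real.exp_nat_mul]
  norm_num

lemma gaussWeight_nine_fourths_lt : gaussWeight (9 / 4) < 0.081 := by
  have h1 : (7.389 : ℝ) < Real.exp 2 := by
    rw [exp_two_eq]
    nlinarith [Real.exp_one_gt_d9]
  have h2 : (1.672 : ℝ) < Real.exp (17 / 32) := by
    have := Real.quadratic_le_exp_of_nonneg (x := 17 / 32) (by norm_num)
    norm_num at *
    linarith
  have h3 : gaussWeight (9 / 4) * (Real.exp 2 * Real.exp (17 / 32)) = 1 := by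
    rw [gaussWeight, ← Real.exp_add, ← Real.exp_add]
    norm_num
  nlinarith [gaussWeight_pos (9 / 4), mul_lt_mul'' h1 h2 (by norm_num) (by norm_num)]

lemma stdNormalTail_nine_fourths_le :
    √(2 * Real.pi) * stdNormalTail (9 / 4) ≤ gaussWeight (9 / 4) * 0.38934 := by
  refine (stdNormalTail_le_mills (by norm_num)).trans ?_
  gcongr
  · exact (gaussWeight_pos _).le
  · norm_num

lemma le_stdNormalTail_nine_fourths :
    gaussWeight (9 / 4) * 0.3837 ≤ √(2 * Real.pi) * stdNormalTail (9 / 4) := by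
  refine le_trans ?_ (mills_le_stdNormalTail (by norm_num))
  gcongr
  · exact (gaussWeight_pos _).le
  · norm_num

lemma log_stdNormalTail_nine_fourths_le :
    Real.log (stdNormalTail (9 / 4)) ≤ -(81 / 32) - 1.86 := by
  rw [Real.log_le_iff_le_exp (stdNormalTail_pos _), sub_eq_add_neg, Real.exp_add]
  have hE : Real.exp (-(81 / 32)) = gaussWeight (9 / 4) := by
    rw [gaussWeight]
    norm_num
  rw [hE]
  have h1 : Real.exp 2 < 7.3891 := by
    rw [exp_two_eq]
    nlinarith [Real.exp_one_lt_d9, Real.exp_one_gt_d9]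
  have h2 : (1.1498 : ℝ) ≤ Real.exp 0.14 := by
    have := Real.quadratic_le_exp_of_nonneg (x := 0.14) (by norm_num)
    norm_num at *
    linarith
  have h3 : Real.exp (-1.86) * Real.exp 2 = Real.exp 0.14 := by
    rw [← Real.exp_add]
    norm_num
  have h4 : (0.1555 : ℝ) ≤ Real.exp (-1.86) := by
    nlinarith [Real.exp_pos (-1.86), Real.exp_pos 2]
  have h5 := stdNormalTail_nine_fourths_le
  nlinarith [sqrt_two_pi_gt, gaussWeight_pos (9 / 4), stdNormalTail_pos (9 / 4)]

lemma varianceGap_nine_fourths_neg : varianceGap 0.036 (9 / 4) < 0 := by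
  have hs := sqrt_two_pi_pos
  have hs' := sqrt_two_pi_lt
  have hl := log_two_pos
  have hl' := Real.log_two_lt_d9
  have hE := gaussWeight_pos (9 / 4)
  have hp := stdNormalTail_pos (9 / 4)
  have h1 := stdNormalTail_nine_fourths_le
  have hq : slopePoly 0.036 (9 / 4) = 1.47475 := by
    unfold slopePoly
    norm_num
  have h2 : stdNormalTail (9 / 4) * (1 - stdNormalTail (9 / 4)) < stdNormalTail (9 / 4) := by
    nlinarith
  rw [varianceGap, hq, sub_neg]
  refine h2.trans_le ?_
  rw [le_div_iff₀ (by positivity)]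
  have h3 : √(2 * Real.pi) * Real.log 2 ≤ 2.50663 * 0.693148 :=
    mul_le_mul hs'.le (by linarith) hl.le (by norm_num)
  calc _ = √(2 * Real.pi) * stdNormalTail (9 / 4) * (√(2 * Real.pi) * Real.log 2) * 1.47475 := by
        ring
    _ ≤ gaussWeight (9 / 4) * 0.38934 * (2.50663 * 0.693148) * 1.47475 := by gcongr
    _ ≤ gaussWeight (9 / 4) := by nlinarith

lemma curvature_nine_fourths_gt : 2 * Real.log 2 < curvature 0.036 (9 / 4) := by
  have hl' := Real.log_two_lt_d9
  have hE := gaussWeight_pos (9 / 4)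
  have hE' := gaussWeight_nine_fourths_lt
  have hq : slopePoly 0.036 (9 / 4) = 1.47475 := by
    unfold slopePoly
    norm_num
  rw [curvature, hq, lt_div_iff₀ (by positivity)]
  nlinarith [log_two_pos]

lemma entropyGap_nine_fourths_pos : 0 < entropyGap 0.036 (9 / 4) := by
  have hs := sqrt_two_pi_gt
  have hs' := sqrt_two_pi_lt
  have hl := log_two_pos
  have hl' := Real.log_two_lt_d9
  have hE := gaussWeight_pos (9 / 4)
  have hE' := gaussWeight_nine_fourths_lt
  have hp := stdNormalTail_pos (9 / 4)
  have hp1 := stdNormalTail_lt_one (9 / 4)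
  have hup := stdNormalTail_nine_fourths_le
  have hlo := le_stdNormalTail_nine_fourths
  have hlog := log_stdNormalTail_nine_fourths_le
  set p := stdNormalTail (9 / 4) with hpdef
  set E := gaussWeight (9 / 4) with hEdef
  have hp2 : p ≤ 0.0126 := by nlinarith
  have hlog1 : Real.log (1 - p) ≤ -p := by
    have := Real.log_le_sub_one_of_pos (sub_pos.2 hp1)
    linarith
  have hH : p * 5.3786 ≤ Real.binEntropy p := by
    rw [Real.binEntropy, Real.log_inv, Real.log_inv]
    have h1 : p * (81 / 32 + 1.86) ≤ p * -Real.log p :=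
      mul_le_mul_of_nonneg_left (by linarith) hp.le
    have h2 : (1 - p) * p ≤ (1 - p) * -Real.log (1 - p) :=
      mul_le_mul_of_nonneg_left (by linarith) (by linarith)
    nlinarith
  have hG : gaussPoly 0.036 (9 / 4) = E * 1.18225 := by
    rw [gaussPoly, ← hEdef]
    norm_num
  have h3 : E * 1.18225 * Real.log 2 < Real.binEntropy p := by
    have h4 : √(2 * Real.pi) * (E * 1.18225 * Real.log 2) < √(2 * Real.pi) * (p * 5.3786) := by
      calc _ ≤ 2.50663 * (E * 1.18225 * 0.693148) := by gcongr; linarith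
        _ < E * 0.3837 * 5.3786 := by nlinarith
        _ ≤ √(2 * Real.pi) * p * 5.3786 := by gcongr
        _ = _ := by ring
    exact (lt_of_mul_lt_mul_left h4 sqrt_two_pi_pos.le).trans_le hH
  rw [entropyGap, hG, ← hpdef, binEnt_eq, sub_pos, lt_div_iff₀ hl]
  exact h3

lemma gaussPoly_le_entropy {x : ℝ} (hx : 0 < x) (hx' : x ≤ 9 / 4) :
    gaussPoly 0.036 x ≤ binEnt (stdNormalTail x) := by
  have ha0 : (0 : ℝ) ≤ 0.036 := by norm_num
  have ha1 : (0.036 : ℝ) < 1 / 2 := by norm_num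
  have hpoly : StaysNeg (Ioc 0 (9 / 4)) (fun x => curvaturePoly 0.036 (x ^ 2)) := by
    intro x hx y hy hxy hneg
    have h1 : x ^ 2 < y ^ 2 := pow_lt_pow_left₀ hxy hx.1.le (by norm_num)
    have h0 : 0 < x ^ 2 := pow_pos hx.1 2
    simp only at hneg ⊢
    generalize x ^ 2 = u at *
    generalize y ^ 2 = v at *
    have h2 : curvaturePoly 0.036 v * u ≤ curvaturePoly 0.036 u * v := by
      have h3 : 0 ≤ (v - u) * (u * v) := by
        have := sub_pos.2 h1
        have := h0.trans h1
        positivity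
      have h4 : 0 ≤ (v - u) * (u * v) * (u + v) := mul_nonneg h3 (by linarith)
      unfold curvaturePoly
      nlinarith
    have h5 : curvaturePoly 0.036 u * v < 0 := mul_neg_of_neg_of_pos hneg (h0.trans h1)
    by_contra! hc
    linarith [mul_nonneg hc h0.le]
  have hcurv : StaysNeg (Ioc 0 (9 / 4)) (fun x => 2 * Real.log 2 - curvature 0.036 x) := by
    refine StaysNeg.of_neg_deriv (Ioc_subset_Ioc_zero _)
      (fun x => (hasDerivAt_curvature ha0 ha1 x).const_sub (2 * Real.log 2))
      (.of_neg (by norm_num) (sub_neg.2 curvature_nine_fourths_gt)) ?_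
    refine (hpoly.mul_pos (w := fun x => x / (slopePoly 0.036 x ^ 4 * gaussWeight x))
      fun x hx => div_pos hx.1 (mul_pos (pow_pos (slopePoly_pos ha0 ha1 x) 4)
        (gaussWeight_pos x))).congr fun x => by ring
  have h := entropyGap_nonneg_of_curvature (Ioc_subset_Ioc_zero _) ha0 ha1 hcurv
    (.of_neg (by norm_num) varianceGap_nine_fourths_neg)
    (.of_neg (by norm_num) (neg_neg_of_pos entropyGap_nine_fourths_pos)) x ⟨hx, hx'⟩
  simpa [entropyGap] using h

/-! ### Integration -/

lemma integral_sq_mul_gaussWeight_Ioi (x : ℝ) :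
    ∫ t in Ioi x, t ^ 2 * gaussWeight t =
      x * gaussWeight x + √(2 * Real.pi) * stdNormalTail x := by
  have hd : ∀ t ∈ Ioi x, HasDerivAt (fun t => t * gaussWeight t)
      (gaussWeight t - t ^ 2 * gaussWeight t) t := fun t _ =>
    ((hasDerivAt_id t).mul (hasDerivAt_gaussWeight t)).congr_deriv (by simp only [id]; ring)
  have h := integral_Ioi_of_hasDerivAt_of_tendsto (f := fun t => t * gaussWeight t)
    (continuous_id.mul continuous_gaussWeight).continuousWithinAt hd
    (integrable_gaussWeight.sub integrable_sq_mul_gaussWeight).integrableOn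
    (by simpa using tendsto_pow_mul_gaussWeight 1)
  rw [integral_sub integrable_gaussWeight.integrableOn
    integrable_sq_mul_gaussWeight.integrableOn, integral_gaussWeight_Ioi] at h
  linarith

lemma integrable_gaussPoly (a : ℝ) : Integrable (gaussPoly a) := by
  refine (integrable_gaussWeight.add (integrable_sq_mul_gaussWeight.const_mul a)).congr
    (Eventually.of_forall fun x => ?_)
  simp only [Pi.add_apply, gaussPoly]
  ring

lemma integral_gaussPoly_Ioi_zero (a : ℝ) :
    ∫ x in Ioi 0, gaussPoly a x = √(2 * Real.pi) / 2 * (1 + a) := by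
  have h : ∀ x, gaussPoly a x = gaussWeight x + a * (x ^ 2 * gaussWeight x) := fun x => by
    rw [gaussPoly]
    ring
  simp only [h]
  rw [integral_add integrable_gaussWeight.integrableOn
    (integrable_sq_mul_gaussWeight.const_mul a).integrableOn, integral_const_mul,
    integral_gaussWeight_Ioi_zero, integral_sq_mul_gaussWeight_Ioi, stdNormalTail_zero]
  ring

lemma continuous_entropy_stdNormalTail : Continuous (fun x => binEnt (stdNormalTail x)) := by
  have h : Continuous stdNormalTail :=
    continuous_iff_continuousAt.2 fun x => (hasDerivAt_stdNormalTail x).continuousAt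
  simp only [binEnt_eq]
  exact (Real.binEntropy_continuous.comp h).div_const _

lemma integrableOn_entropy_stdNormalTail :
    IntegrableOn (fun x => binEnt (stdNormalTail x)) (Ioi 0) := by
  refine (integrable_gaussPoly 0.045).integrableOn.mono'
    continuous_entropy_stdNormalTail.aestronglyMeasurable ?_
  filter_upwards [ae_restrict_mem measurableSet_Ioi] with x hx
  rw [Real.norm_of_nonneg ((gaussWeight_pos x).le.trans (gaussWeight_le_entropy hx))]
  exact entropy_le_gaussPoly hx

lemma integral_entropy_lt : ∫ x in Ioi (0 : ℝ), binEnt (stdNormalTail x) < 1.31 := by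
  have h := setIntegral_mono_on integrableOn_entropy_stdNormalTail
    (integrable_gaussPoly 0.045).integrableOn measurableSet_Ioi fun x hx => entropy_le_gaussPoly hx
  rw [integral_gaussPoly_Ioi_zero] at h
  have := sqrt_two_pi_lt
  norm_num at *
  linarith

lemma lt_integral_entropy : 1.29 < ∫ x in Ioi (0 : ℝ), binEnt (stdNormalTail x) := by
  have hi : Integrable ((Ioi (9 / 4 : ℝ)).indicator
      (fun x => 0.036 * (x ^ 2 * gaussWeight x))) :=
    (integrable_sq_mul_gaussWeight.const_mul 0.036).indicator measurableSet_Ioi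
  have h := setIntegral_mono_on
    ((integrable_gaussPoly 0.036).sub hi).integrableOn integrableOn_entropy_stdNormalTail
    measurableSet_Ioi fun x (hx : 0 < x) => by
      simp only [Pi.sub_apply]
      by_cases hx' : x ≤ 9 / 4
      · rw [indicator_of_notMem (by simpa using hx'), sub_zero]
        exact gaussPoly_le_entropy hx hx'
      · rw [indicator_of_mem (by simpa using hx')]
        refine le_trans (le_of_eq ?_) (gaussWeight_le_entropy hx)
        rw [gaussPoly]
        ring
  simp only [Pi.sub_apply] at h
  rw [integral_sub (integrable_gaussPoly 0.036).integrableOn hi.integrableOn,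
    integral_gaussPoly_Ioi_zero, setIntegral_indicator measurableSet_Ioi,
    inter_eq_right.2 (Ioi_subset_Ioi (by norm_num)), integral_const_mul,
    integral_sq_mul_gaussWeight_Ioi] at h
  have h1 := sqrt_two_pi_gt
  have h2 := stdNormalTail_nine_fourths_le
  have h3 := gaussWeight_nine_fourths_lt
  norm_num at *
  linarith

/-- The integral `α = ∫₀^∞ H₂(Φ(x)) dx` converges and satisfies `1.29 < α < 1.31`
(numerically `α ≈ 1.303`). -/
theorem alpha_integral_bounds :
    IntegrableOn (fun x => binEnt (stdNormalTail x)) (Set.Ioi 0) ∧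
    1.29 < (∫ x in Set.Ioi (0 : ℝ), binEnt (stdNormalTail x)) ∧
    (∫ x in Set.Ioi (0 : ℝ), binEnt (stdNormalTail x)) < 1.31 :=
  ⟨integrableOn_entropy_stdNormalTail, lt_integral_entropy, integral_entropy_lt⟩
end

section
/- For every real c > 0: ∫_{−∞}^{∞} φ_{0, √(1/2 + 1/c²)}(y) · H₂(Φ(c·|y| / √(1 + 2/c²))) dy = ∫_{−∞}^{∞} φ_{0, 1/√2}(x) · H₂(Φ(c·|x|)) dx. (This expresses the symmetry I(h(p)|f(q)) = I(h(q)|f(p)) for the sign-bit hash of a one-dimensional Gaussian projection, where f(p) ~ N(0, 1/2) and f(q) = f(p) + Z with Z ~ N(0, 1/c²) independent.) -/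
/-- The Gaussian probability density with mean `μ` and standard deviation `σ`. -/
noncomputable def gaussDensity (μ σ t : ℝ) : ℝ :=
  (σ * Real.sqrt (2 * Real.pi))⁻¹ * Real.exp (-((t - μ) ^ 2) / (2 * σ ^ 2))

/-- Rescaling a centred Gaussian density by a positive factor. -/
theorem mul_gaussDensity_zero_mul {s : ℝ} (hs : 0 < s) (σ x : ℝ) :
    s * gaussDensity 0 (s * σ) (s * x) = gaussDensity 0 σ x := by
  have h1 : -((s * x - 0) ^ 2) / (2 * (s * σ) ^ 2) = -((x - 0) ^ 2) / (2 * σ ^ 2) := by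
    rw [show -((s * x - 0) ^ 2) = s ^ 2 * -((x - 0) ^ 2) by ring,
      show 2 * (s * σ) ^ 2 = s ^ 2 * (2 * σ ^ 2) by ring,
      mul_div_mul_left _ _ (pow_ne_zero 2 hs.ne')]
  rw [gaussDensity, gaussDensity, h1, mul_assoc s σ, mul_inv s, ← mul_assoc, ← mul_assoc,
    mul_inv_cancel₀ hs.ne', one_mul]

/-- Symmetry `I(h(p)|f(q)) = I(h(q)|f(p))` for the sign-bit hash of a one-dimensional
Gaussian projection, where `f(p) ~ N(0, 1/2)` and `f(q) = f(p) + Z` with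
`Z ~ N(0, 1/c²)` independent. -/
theorem sign_bit_entropy_symmetry (c : ℝ) (hc : 0 < c) :
    (∫ y : ℝ, gaussDensity 0 (Real.sqrt (1 / 2 + 1 / c ^ 2)) y *
        binEnt (stdNormalTail (c * |y| / Real.sqrt (1 + 2 / c ^ 2)))) =
      ∫ x : ℝ, gaussDensity 0 (1 / Real.sqrt 2) x * binEnt (stdNormalTail (c * |x|)) := by
  have hs : 0 < Real.sqrt (1 + 2 / c ^ 2) := Real.sqrt_pos.mpr (by positivity)
  have hσ : Real.sqrt (1 / 2 + 1 / c ^ 2) = Real.sqrt (1 + 2 / c ^ 2) * (1 / Real.sqrt 2) := by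
    rw [mul_one_div, ← Real.sqrt_div (by positivity)]
    congr 1
    ring
  rw [hσ]
  generalize Real.sqrt (1 + 2 / c ^ 2) = s at hs ⊢
  have h := MeasureTheory.Measure.integral_comp_mul_left
    (fun y : ℝ => gaussDensity 0 (s * (1 / Real.sqrt 2)) y *
      binEnt (stdNormalTail (c * |y| / s))) s
  rw [abs_of_pos (inv_pos.mpr hs), smul_eq_mul, eq_inv_mul_iff_mul_eq₀ hs.ne',
    ← MeasureTheory.integral_const_mul] at h
  rw [← h]
  refine MeasureTheory.integral_congr_ae (Filter.Eventually.of_forall fun x => ?_)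
  have harg : c * |s * x| / s = c * |x| := by
    rw [abs_mul, abs_of_pos hs]
    field_simp
  simp only [harg]
  rw [← mul_assoc, mul_gaussDensity_zero_mul hs]
end

section
/- Fix D > 0 and let ι(w) = −w·log₂ w. Then as c → ∞, c·D · [ (1/D)·∫₀^D ι( Φ(c·x) − Φ(c·x + c·D) ) dx ] converges to ∫₀^∞ ι(Φ(x)) dx. (The bracketed quantity is M₁, the contribution of the event h(p) − h(q) = 1 to the conditional entropy of the interval-hash difference for points p, q at distance 1/c, given the offset r(q) of q within its length-D interval.) -/
open Filter

/-- `ι(w) = −w·log₂ w`, with the convention `ι(0) = 0`. -/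
noncomputable def entTerm (w : ℝ) : ℝ := -(w * Real.logb 2 w)

open MeasureTheory

lemma integrable_exp_neg_sq_div_two :
    Integrable (fun t : ℝ => Real.exp (-(t ^ 2) / 2)) := by
  have h := integrable_exp_neg_mul_sq (b := 1 / 2) (by norm_num)
  refine h.congr (Eventually.of_forall fun t => ?_)
  change Real.exp _ = Real.exp _
  congr 1
  ring

lemma stdNormalTail_nonneg (x : ℝ) : 0 ≤ stdNormalTail x := by
  unfold stdNormalTail
  have : 0 ≤ ∫ t in Set.Ioi x, Real.exp (-(t ^ 2) / 2) :=
    integral_nonneg fun t => (Real.exp_pos _).le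
  positivity

lemma stdNormalTail_le_one (x : ℝ) : stdNormalTail x ≤ 1 := by
  unfold stdNormalTail
  have h₁ : ∫ t in Set.Ioi x, Real.exp (-(t ^ 2) / 2) ≤ ∫ t : ℝ, Real.exp (-(t ^ 2) / 2) :=
    setIntegral_le_integral integrable_exp_neg_sq_div_two
      (Eventually.of_forall fun t => (Real.exp_pos _).le)
  have h₂ : ∫ t : ℝ, Real.exp (-(t ^ 2) / 2) = Real.sqrt (2 * Real.pi) := by
    have h := integral_gaussian (1 / 2)
    rw [show Real.pi / (1 / 2) = 2 * Real.pi by ring] at h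
    rw [← h]
    congr 1
    ext t
    congr 1
    ring
  have hpos : 0 < Real.sqrt (2 * Real.pi) := by positivity
  rw [inv_mul_le_iff₀ hpos, mul_one, ← h₂]
  exact h₁

lemma antitone_stdNormalTail : Antitone stdNormalTail := by
  intro x y hxy
  unfold stdNormalTail
  refine mul_le_mul_of_nonneg_left ?_ (by positivity)
  exact setIntegral_mono_set integrable_exp_neg_sq_div_two.integrableOn
    (Eventually.of_forall fun t => (Real.exp_pos _).le)
    (Set.Ioi_subset_Ioi hxy).eventuallyLE

lemma stdNormalTail_le_exp (x : ℝ) :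
    stdNormalTail x ≤ (Real.sqrt (2 * Real.pi))⁻¹ * Real.exp (1 / 2) * Real.exp (-x) := by
  unfold stdNormalTail
  rw [mul_assoc]
  refine mul_le_mul_of_nonneg_left ?_ (by positivity)
  rw [← integral_exp_neg_Ioi x, ← integral_const_mul]
  refine integral_mono integrable_exp_neg_sq_div_two.integrableOn
    ((integrableOn_exp_neg_Ioi x).const_mul _) fun t => ?_
  change Real.exp _ ≤ Real.exp _ * Real.exp _
  rw [← Real.exp_add]
  exact Real.exp_le_exp.mpr (by nlinarith [sq_nonneg (t - 1)])

lemma tendsto_stdNormalTail_atTop : Tendsto stdNormalTail atTop (nhds 0) := by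
  refine squeeze_zero stdNormalTail_nonneg stdNormalTail_le_exp ?_
  simpa using Real.tendsto_exp_neg_atTop_nhds_zero.const_mul
    ((Real.sqrt (2 * Real.pi))⁻¹ * Real.exp (1 / 2))

lemma continuous_entTerm : Continuous entTerm := by
  have h : entTerm = fun w => -(w * Real.log w) / Real.log 2 := by
    ext w
    simp only [entTerm, Real.logb]
    ring
  rw [h]
  exact Real.continuous_mul_log.neg.div_const _

lemma abs_entTerm_le_sqrt {w : ℝ} (h₀ : 0 ≤ w) (h₁ : w ≤ 1) :
    |entTerm w| ≤ 2 / Real.log 2 * Real.sqrt w := by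
  rcases h₀.eq_or_lt with rfl | hw
  · simp [entTerm]
  have hlog : 0 < Real.log 2 := Real.log_pos one_lt_two
  have h := (Real.abs_log_mul_self_rpow_lt w (1 / 2) hw h₁ (by norm_num)).le
  rw [← Real.sqrt_eq_rpow] at h
  have hs : entTerm w = -(Real.log w * Real.sqrt w * Real.sqrt w) / Real.log 2 := by
    rw [mul_assoc, Real.mul_self_sqrt h₀]
    simp only [entTerm, Real.logb]
    ring
  rw [hs, abs_div, abs_neg, abs_mul, abs_of_pos hlog, abs_of_nonneg (Real.sqrt_nonneg w),
    div_mul_eq_mul_div]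
  gcongr
  norm_num at h ⊢
  exact h

lemma abs_entTerm_le_exp {w x : ℝ} (h₀ : 0 ≤ w) (hx : w ≤ stdNormalTail x) :
    |entTerm w| ≤ 2 / Real.log 2 *
      Real.sqrt ((Real.sqrt (2 * Real.pi))⁻¹ * Real.exp (1 / 2)) * Real.exp (-(1 / 2) * x) := by
  have hlog : 0 < Real.log 2 := Real.log_pos one_lt_two
  refine (abs_entTerm_le_sqrt h₀ (hx.trans (stdNormalTail_le_one x))).trans ?_
  rw [mul_assoc, show -(1 / 2) * x = -x / 2 by ring, Real.exp_half (-x),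
    ← Real.sqrt_mul (by positivity)]
  gcongr
  exact hx.trans (stdNormalTail_le_exp x)

lemma mul_integral_entTerm_eq {D c : ℝ} (hD : 0 < D) (hc : 0 < c) :
    c * D * ((1 / D) * ∫ x in (0 : ℝ)..D,
      entTerm (stdNormalTail (c * x) - stdNormalTail (c * x + c * D))) =
    ∫ y in Set.Ioi (0 : ℝ), (Set.Iic (c * D)).indicator
      (fun y => entTerm (stdNormalTail y - stdNormalTail (y + c * D))) y := by
  rw [intervalIntegral.integral_comp_mul_left
    (fun y => entTerm (stdNormalTail y - stdNormalTail (y + c * D))) hc.ne', mul_zero,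
    intervalIntegral.integral_of_le (by positivity), setIntegral_indicator measurableSet_Iic,
    Set.Ioi_inter_Iic, smul_eq_mul]
  field_simp

/-- Asymptotics of `M₁`, the contribution of the event `h(p) − h(q) = 1` to the
conditional entropy of the interval-hash difference: as `c → ∞`,
`c·D · [(1/D)·∫₀^D ι(Φ(c·x) − Φ(c·x + c·D)) dx]` converges to `∫₀^∞ ι(Φ(x)) dx`. -/
theorem interval_hash_M1_limit (D : ℝ) (hD : 0 < D) :
    Tendsto (fun c : ℝ => c * D *
        ((1 / D) * ∫ x in (0 : ℝ)..D, entTerm (stdNormalTail (c * x) - stdNormalTail (c * x + c * D))))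
      atTop (nhds (∫ x in Set.Ioi (0 : ℝ), entTerm (stdNormalTail x))) := by
  have hmeas := antitone_stdNormalTail.measurable
  refine Tendsto.congr' ((eventually_gt_atTop 0).mono fun c hc =>
    (mul_integral_entTerm_eq hD hc).symm) ?_
  refine tendsto_integral_filter_of_dominated_convergence
    (fun x => 2 / Real.log 2 *
      Real.sqrt ((Real.sqrt (2 * Real.pi))⁻¹ * Real.exp (1 / 2)) * Real.exp (-(1 / 2) * x))
    ?_ ?_ ?_ ?_
  · refine Eventually.of_forall fun c => Measurable.aestronglyMeasurable ?_
    exact (continuous_entTerm.measurable.comp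
      (hmeas.sub (hmeas.comp (measurable_id.add_const _)))).indicator measurableSet_Iic
  · refine (eventually_gt_atTop (0 : ℝ)).mono fun c hc => Eventually.of_forall fun y => ?_
    refine (norm_indicator_le_norm_self _ _).trans ?_
    have h := antitone_stdNormalTail (le_add_of_nonneg_right (mul_pos hc hD).le : y ≤ y + c * D)
    exact abs_entTerm_le_exp (sub_nonneg.mpr h) (sub_le_self _ (stdNormalTail_nonneg _))
  · exact (exp_neg_integrableOn_Ioi 0 (by norm_num)).const_mul _
  · refine Eventually.of_forall fun y => ?_
    have hcD : Tendsto (fun c : ℝ => c * D) atTop atTop := tendsto_id.atTop_mul_const hD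
    have hlim : Tendsto (fun c : ℝ => entTerm (stdNormalTail y - stdNormalTail (y + c * D)))
        atTop (nhds (entTerm (stdNormalTail y))) := by
      have h := (tendsto_stdNormalTail_atTop.comp
        (tendsto_atTop_add_const_left _ y hcD)).const_sub (stdNormalTail y)
      rw [sub_zero] at h
      exact (continuous_entTerm.tendsto _).comp h
    refine hlim.congr' ((hcD.eventually_ge_atTop y).mono fun c hc => ?_)
    simp only [Set.indicator_of_mem (Set.mem_Iic.mpr hc)]
end

section
/- For every D > 0: 2·∫₀^D (x/D)·(1/√(2π))·e^{−x²/2} dx = (1/D)·√(2/π)·(1 − e^{−D²/2}). Consequently, if two projected values are X apart with X ~ N(0, 1) and the real line is partitioned into intervals of length D with a uniformly random shift, the probability that the two values land in different intervals is at least (1/D)·√(2/π)·(1 − e^{−D²/2}), so the collision probability g satisfies g ≤ 1 − (1/D)·√(2/π)·(1 − e^{−D²/2}). -/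
open ProbabilityTheory

/-- Closed form of the truncated first moment of the Gaussian kernel. -/
theorem integral_mul_exp_neg_sq_div_two (D : ℝ) :
    ∫ x in (0 : ℝ)..D, x * Real.exp (-(x ^ 2) / 2) = 1 - Real.exp (-(D ^ 2) / 2) := by
  have hderiv (x : ℝ) : HasDerivAt (fun y : ℝ => -Real.exp (-(y ^ 2) / 2))
      (x * Real.exp (-(x ^ 2) / 2)) x := by
    refine (((hasDerivAt_pow 2 x).neg.div_const 2).exp).neg.congr_deriv ?_
    simp only [Pi.neg_apply]
    push_cast
    ring
  rw [intervalIntegral.integral_eq_sub_of_hasDerivAt (fun x _ => hderiv x)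
    (Continuous.intervalIntegrable (by fun_prop) _ _)]
  simp
  ring

theorem two_mul_inv_sqrt_two_mul_pi :
    2 * (Real.sqrt (2 * Real.pi))⁻¹ = Real.sqrt (2 / Real.pi) := by
  rw [Real.sqrt_mul zero_le_two, Real.sqrt_div zero_le_two]
  have := Real.sqrt_pos.2 Real.pi_pos
  field_simp
  norm_num

theorem two_mul_integral_div_mul_gaussian (D : ℝ) :
    (2 * ∫ x in (0 : ℝ)..D,
        (x / D) * ((Real.sqrt (2 * Real.pi))⁻¹ * Real.exp (-(x ^ 2) / 2))) =
      (1 / D) * Real.sqrt (2 / Real.pi) * (1 - Real.exp (-(D ^ 2) / 2)) := by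
  have hfactor (x : ℝ) :
      (x / D) * ((Real.sqrt (2 * Real.pi))⁻¹ * Real.exp (-(x ^ 2) / 2)) =
        (1 / D * (Real.sqrt (2 * Real.pi))⁻¹) * (x * Real.exp (-(x ^ 2) / 2)) := by
    ring
  simp_rw [hfactor]
  rw [intervalIntegral.integral_const_mul, integral_mul_exp_neg_sq_div_two,
    ← two_mul_inv_sqrt_two_mul_pi]
  ring

/-- The Gaussian integral of the separation probability dominates its part on `[-D, D]`. -/
theorem two_mul_integral_le_integral_min_gaussianReal {D : ℝ} (hD : 0 < D) :
    (2 * ∫ x in (0 : ℝ)..D,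
        (x / D) * ((Real.sqrt (2 * Real.pi))⁻¹ * Real.exp (-(x ^ 2) / 2))) ≤
      ∫ x, min (|x| / D) 1 ∂(gaussianReal 0 1) := by
  have hpdf (x : ℝ) :
      gaussianPDFReal 0 1 x = (Real.sqrt (2 * Real.pi))⁻¹ * Real.exp (-(x ^ 2) / 2) := by
    simp [gaussianPDFReal]
  have habs (x : ℝ) : gaussianPDFReal 0 1 |x| = gaussianPDFReal 0 1 x := by
    simp only [hpdf, sq_abs]
  have hfold : ∫ x, min (|x| / D) 1 ∂(gaussianReal 0 1) =
      2 * ∫ x in Set.Ioi (0 : ℝ), gaussianPDFReal 0 1 x * min (x / D) 1 := by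
    rw [integral_gaussianReal_eq_integral_smul one_ne_zero, ← integral_comp_abs]
    simp only [habs, smul_eq_mul]
  have hnonneg : ∀ x ∈ Set.Ioi (0 : ℝ), 0 ≤ gaussianPDFReal 0 1 x * min (x / D) 1 :=
    fun x hx => mul_nonneg (gaussianPDFReal_nonneg 0 1 x)
      (le_min (div_nonneg (le_of_lt hx) hD.le) zero_le_one)
  have hint : MeasureTheory.IntegrableOn
      (fun x => gaussianPDFReal 0 1 x * min (x / D) 1) (Set.Ioi 0) := by
    refine (integrable_gaussianPDFReal 0 1).integrableOn.mono'
      (by fun_prop) ?_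
    filter_upwards [MeasureTheory.ae_restrict_mem measurableSet_Ioi] with x hx
    rw [Real.norm_of_nonneg (hnonneg x hx)]
    exact mul_le_of_le_one_right (gaussianPDFReal_nonneg 0 1 x) (min_le_right _ _)
  rw [hfold, intervalIntegral.integral_of_le hD.le]
  refine mul_le_mul_of_nonneg_left ?_ zero_le_two
  calc ∫ x in Set.Ioc 0 D,
        (x / D) * ((Real.sqrt (2 * Real.pi))⁻¹ * Real.exp (-(x ^ 2) / 2))
      = ∫ x in Set.Ioc 0 D, gaussianPDFReal 0 1 x * min (x / D) 1 := by
        refine MeasureTheory.setIntegral_congr_fun measurableSet_Ioc fun x hx => ?_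
        simp only [hpdf, min_eq_left ((div_le_one hD).2 hx.2)]
        ring
    _ ≤ ∫ x in Set.Ioi 0, gaussianPDFReal 0 1 x * min (x / D) 1 :=
        MeasureTheory.setIntegral_mono_set hint
          ((MeasureTheory.ae_restrict_mem measurableSet_Ioi).mono hnonneg)
          (Set.Ioc_subset_Ioi_self.eventuallyLE)

/-- The probability that a randomly shifted partition of the line into length-`D`
intervals separates two values `X` apart, with `X ~ N(0,1)`, is at least
`(1/D)·√(2/π)·(1 − e^{−D²/2})`, via the identity
`2·∫₀^D (x/D)·η(x) dx = (1/D)·√(2/π)·(1 − e^{−D²/2})` where `η` is the standard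
normal density.  Hence the collision probability `g` of the width-`D` interval hash
satisfies `g ≤ 1 − (1/D)·√(2/π)·(1 − e^{−D²/2})`. -/
theorem interval_hash_separation (D : ℝ) (hD : 0 < D) :
    (2 * ∫ x in (0 : ℝ)..D,
        (x / D) * ((Real.sqrt (2 * Real.pi))⁻¹ * Real.exp (-(x ^ 2) / 2))) =
      (1 / D) * Real.sqrt (2 / Real.pi) * (1 - Real.exp (-(D ^ 2) / 2)) ∧
    (1 / D) * Real.sqrt (2 / Real.pi) * (1 - Real.exp (-(D ^ 2) / 2)) ≤
      ∫ x, min (|x| / D) 1 ∂(gaussianReal 0 1) := by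
  refine ⟨two_mul_integral_div_mul_gaussian D, ?_⟩
  rw [← two_mul_integral_div_mul_gaussian D]
  exact two_mul_integral_le_integral_min_gaussianReal hD
end

section
/- Let D > 0, let β be uniformly distributed on [0, D], and let a, b be real numbers. Then P[ ⌊(a + β)/D⌋ ≠ ⌊(b + β)/D⌋ ] = min(|a − b|/D, 1). -/
open MeasureTheory

/-- A measurable `D`-periodic set has the same volume in `[0, D]` as in any `[t, t + D)`. -/
theorem volume_inter_Icc_eq_of_periodic {D : ℝ} (hD : 0 < D) {S : Set ℝ} (hS : MeasurableSet S)
    (hper : ∀ (n : ℤ) (x : ℝ), n • D + x ∈ S ↔ x ∈ S) (t : ℝ) :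
    volume (S ∩ Set.Icc 0 D) = volume (S ∩ Set.Ico t (t + D)) := by
  have key := (isAddFundamentalDomain_Ioc hD 0 volume).measure_set_eq
    (isAddFundamentalDomain_Ioc hD t volume) hS (by
      rintro ⟨g, hg⟩
      obtain ⟨n, rfl⟩ := AddSubgroup.mem_zmultiples_iff.mp hg
      ext x
      exact hper n x)
  rw [zero_add] at key
  calc volume (S ∩ Set.Icc 0 D) = volume (S ∩ Set.Ioc 0 D) :=
        measure_congr ((Filter.EventuallyEq.refl _ S).inter Ioc_ae_eq_Icc.symm)
    _ = volume (S ∩ Set.Ioc t (t + D)) := key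
    _ = volume (S ∩ Set.Ico t (t + D)) :=
        measure_congr ((Filter.EventuallyEq.refl _ S).inter Ico_ae_eq_Ioc.symm)

theorem measurableSet_floor_shift_ne (D a b : ℝ) :
    MeasurableSet {β : ℝ | ⌊(a + β) / D⌋ ≠ ⌊(b + β) / D⌋} :=
  (measurableSet_eq_fun (by fun_prop) (by fun_prop)).compl

/-- The volume of the shifts in `[0, D]` that separate `a` and `b`, for `a ≤ b`. -/
theorem volume_floor_shift_ne_inter_Icc {D : ℝ} (hD : 0 < D) {a b : ℝ} (hab : a ≤ b) :
    volume ({β : ℝ | ⌊(a + β) / D⌋ ≠ ⌊(b + β) / D⌋} ∩ Set.Icc 0 D) =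
      ENNReal.ofReal (min (b - a) D) := by
  rcases le_or_gt D (b - a) with h | h
  · have hsub : Set.Icc 0 D ⊆ {β : ℝ | ⌊(a + β) / D⌋ ≠ ⌊(b + β) / D⌋} := by
      intro β _
      have h1 : (a + β) / D + 1 ≤ (b + β) / D := by
        rw [div_add_one hD.ne']
        exact div_le_div_of_nonneg_right (by linarith) hD.le
      have h2 := Int.floor_le_floor h1
      rw [Int.floor_add_one] at h2
      exact (Int.lt_of_add_one_le h2).ne
    rw [Set.inter_eq_right.mpr hsub, Real.volume_Icc, sub_zero, min_eq_right h]
  · rw [volume_inter_Icc_eq_of_periodic hD (measurableSet_floor_shift_ne D a b) ?_ (-b)]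
    · have hset : {β : ℝ | ⌊(a + β) / D⌋ ≠ ⌊(b + β) / D⌋} ∩ Set.Ico (-b) (-b + D) =
          Set.Ico (-b) (-a) := by
        ext β
        simp only [Set.mem_inter_iff, Set.mem_ofPred_eq, Set.mem_Ico]
        have hb : -b ≤ β → β < -b + D → ⌊(b + β) / D⌋ = 0 := fun h1 h2 =>
          Int.floor_eq_zero_iff.mpr
            ⟨div_nonneg (by linarith) hD.le, (div_lt_one hD).mpr (by linarith)⟩
        constructor
        · rintro ⟨hne, h1, h2⟩
          refine ⟨h1, lt_of_not_ge fun h3 => hne ?_⟩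
          rw [hb h1 h2, Int.floor_eq_zero_iff]
          exact ⟨div_nonneg (by linarith) hD.le, (div_lt_one hD).mpr (by linarith)⟩
        · rintro ⟨h1, h2⟩
          have h3 : β < -b + D := by linarith
          refine ⟨?_, h1, h3⟩
          rw [hb h1 h3]
          exact (Int.floor_lt.mpr (by
            rw [Int.cast_zero]
            exact div_neg_of_neg_of_pos (by linarith) hD)).ne
      rw [hset, Real.volume_Ico, min_eq_left h.le]
      congr 1
      ring
    · intro n x
      have hshift : ∀ c : ℝ, ⌊(c + (n • D + x)) / D⌋ = ⌊(c + x) / D⌋ + n := fun c => by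
        rw [← Int.floor_add_intCast, zsmul_eq_mul]
        congr 1
        field_simp
        ring
      simp only [Set.mem_ofPred_eq, hshift, ne_eq, add_left_inj]

/-- For a uniformly random shift `β` on `[0, D]`, the probability that the randomly
shifted partition of the line into length-`D` intervals separates `a` and `b` is
exactly `min(|a − b|/D, 1)`. -/
theorem shifted_interval_separation_prob (D : ℝ) (hD : 0 < D) (a b : ℝ) :
    ((ENNReal.ofReal D)⁻¹ • volume.restrict (Set.Icc (0 : ℝ) D))
        {β : ℝ | ⌊(a + β) / D⌋ ≠ ⌊(b + β) / D⌋} =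
      ENNReal.ofReal (min (|a - b| / D) 1) := by
  have hvol : volume ({β : ℝ | ⌊(a + β) / D⌋ ≠ ⌊(b + β) / D⌋} ∩ Set.Icc 0 D) =
      ENNReal.ofReal (min |a - b| D) := by
    rcases le_total a b with h | h
    · rw [volume_floor_shift_ne_inter_Icc hD h, abs_sub_comm, abs_of_nonneg (sub_nonneg.mpr h)]
    · simp_rw [ne_comm (a := ⌊(a + _) / D⌋)]
      rw [volume_floor_shift_ne_inter_Icc hD h, abs_of_nonneg (sub_nonneg.mpr h)]
  rw [Measure.smul_apply, Measure.restrict_apply (measurableSet_floor_shift_ne D a b), hvol,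
    smul_eq_mul, mul_comm, ← div_eq_mul_inv, ← ENNReal.ofReal_div_of_pos hD,
    ← min_div_div_right hD.le, div_self hD.ne']
end

section
/- Let D > 0 and σ ≥ 1, let X ~ N(0, σ²) and let β be uniform on [0, D] independent of X. Then for every real a, P[ ⌊(a + β)/D⌋ = ⌊(a + X + β)/D⌋ ] ≤ 1 − (1/D)·√(2/π)·(1 − e^{−D²/2}). In particular, E[min(|X|/D, 1)] ≥ (1/D)·√(2/π)·(1 − e^{−D²/2}), and the bound g on the collision probability of the randomly shifted interval hash for points at projected distance deviation σ = 1 remains valid for all σ ≥ 1. -/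
open MeasureTheory ProbabilityTheory

/-- The length of the shifts in one period for which two points at offset `x` fall in the same
cell of length `D`. -/
lemma volume_floor_eq_floor_le {D : ℝ} (hD : 0 < D) (a x : ℝ) :
    volume ({b : ℝ | ⌊(a + b) / D⌋ = ⌊(a + x + b) / D⌋} ∩ Set.Icc 0 D) ≤
      ENNReal.ofReal (D - |x|) := by
  set S := {b : ℝ | ⌊(a + b) / D⌋ = ⌊(a + x + b) / D⌋} with hS
  have h_meas : MeasurableSet S :=
    measurableSet_eq_fun (by fun_prop) (by fun_prop)
  have h_inv : ∀ g : AddSubgroup.zmultiples D, (fun b : ℝ => g +ᵥ b) ⁻¹' S = S := by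
    rintro ⟨_, n, rfl⟩
    ext b
    have h1 : (a + (n * D + b)) / D = (a + b) / D + n := by field_simp; ring
    have h2 : (a + x + (n * D + b)) / D = (a + x + b) / D + n := by field_simp; ring
    simp [hS, AddSubgroup.vadd_def, h1, h2]
  have h_shift : volume (S ∩ Set.Icc 0 D) = volume (S ∩ Set.Ioo (-a) (-a + D)) := by
    have h := (isAddFundamentalDomain_Ioc hD 0 volume).measure_set_eq
      (isAddFundamentalDomain_Ioc hD (-a) volume) h_meas h_inv
    rw [zero_add] at h
    rw [measure_congr (Filter.EventuallyEq.rfl.inter Ioc_ae_eq_Icc.symm), h,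
      measure_congr (Filter.EventuallyEq.rfl.inter Ioo_ae_eq_Ioc.symm)]
  have h_sub : S ∩ Set.Ioo (-a) (-a + D) ⊆ Set.Icc (-a + max 0 (-x)) (-a + D - max 0 x) := by
    rintro b ⟨hb, hb1, hb2⟩
    have h0 : ⌊(a + b) / D⌋ = 0 := by
      rw [Int.floor_eq_zero_iff, Set.mem_Ico, le_div_iff₀ hD, div_lt_iff₀ hD]
      constructor <;> linarith
    have h1 : ⌊(a + x + b) / D⌋ = 0 := (hb.symm.trans h0)
    rw [Int.floor_eq_zero_iff, Set.mem_Ico, le_div_iff₀ hD, div_lt_iff₀ hD] at h1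
    constructor
    · rcases max_cases 0 (-x) with h | h <;> linarith
    · rcases max_cases 0 x with h | h <;> linarith
  rw [h_shift]
  refine (measure_mono h_sub).trans ?_
  rw [Real.volume_Icc]
  refine ENNReal.ofReal_le_ofReal ?_
  rcases abs_cases x with h | h <;> rcases max_cases 0 (-x) with h' | h' <;>
    rcases max_cases 0 x with h'' | h'' <;> linarith

/-- The first absolute moment of the standard Gaussian truncated to `[-D, D]`. -/
lemma integral_indicator_abs_gaussianReal {D : ℝ} (hD : 0 < D) :
    ∫ x, (Set.Iic D).indicator id |x| ∂(gaussianReal 0 1) =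
      Real.sqrt (2 / Real.pi) * (1 - Real.exp (-(D ^ 2) / 2)) := by
  have h_even : ∀ x : ℝ, gaussianPDFReal 0 1 x • (Set.Iic D).indicator id |x| =
      (fun y => (Set.Iic D).indicator (fun y => gaussianPDFReal 0 1 y * y) y) |x| := by
    intro x
    by_cases h : |x| ∈ Set.Iic D
    · simp [h, gaussianPDFReal]
    · simp [h]
  have h_deriv : ∀ y : ℝ,
      HasDerivAt (fun y => -gaussianPDFReal 0 1 y) (gaussianPDFReal 0 1 y * y) y := by
    intro y
    have h := ((((hasDerivAt_id y).pow 2).neg.div_const 2).exp.const_mul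
      (Real.sqrt (2 * Real.pi))⁻¹).neg
    refine (h.congr_deriv ?_).congr_of_eventuallyEq (.of_forall fun z => ?_)
    · simp [gaussianPDFReal]
      ring
    · simp [gaussianPDFReal]
  have h_sqrt : 2 * (Real.sqrt (2 * Real.pi))⁻¹ = Real.sqrt (2 / Real.pi) := by
    rw [Real.sqrt_mul zero_le_two, Real.sqrt_div zero_le_two]
    have := Real.sq_sqrt (zero_le_two (α := ℝ))
    have := Real.sqrt_pos.2 Real.pi_pos
    field_simp
    linarith
  rw [integral_gaussianReal_eq_integral_smul one_ne_zero]
  simp_rw [h_even]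
  rw [integral_comp_abs, setIntegral_indicator measurableSet_Iic, Set.Ioi_inter_Iic,
    ← intervalIntegral.integral_of_le hD.le,
    intervalIntegral.integral_eq_sub_of_hasDerivAt (fun y _ => h_deriv y)]
  · simp only [gaussianPDFReal, ← h_sqrt]
    simp
    ring
  · refine Continuous.intervalIntegrable ?_ _ _
    unfold gaussianPDFReal
    fun_prop

lemma integrable_min_abs_div_one {D : ℝ} (hD : 0 < D) (μ : Measure ℝ) [IsFiniteMeasure μ] :
    Integrable (fun x => min (|x| / D) 1) μ := by
  refine Integrable.of_bound (by fun_prop) 1 (ae_of_all _ fun x => ?_)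
  rw [Real.norm_of_nonneg (by positivity)]
  exact min_le_right _ _

lemma le_integral_min_abs_div_one_gaussianReal {D σ : ℝ} (hD : 0 < D) (hσ : 1 ≤ σ) :
    (1 / D) * Real.sqrt (2 / Real.pi) * (1 - Real.exp (-(D ^ 2) / 2)) ≤
      ∫ x, min (|x| / D) 1 ∂(gaussianReal 0 (Real.toNNReal (σ ^ 2))) := by
  have h_map : gaussianReal 0 (Real.toNNReal (σ ^ 2)) =
      (gaussianReal 0 1).map (σ * ·) := by
    rw [gaussianReal_map_const_mul, mul_zero, mul_one]
    congr 1
    exact Real.toNNReal_of_nonneg (sq_nonneg σ)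
  rw [mul_assoc, ← integral_indicator_abs_gaussianReal hD, ← integral_const_mul]
  have h_int := integrable_min_abs_div_one hD (gaussianReal 0 (Real.toNNReal (σ ^ 2)))
  rw [h_map] at h_int ⊢
  rw [integral_map (by fun_prop) h_int.aestronglyMeasurable]
  refine integral_mono_of_nonneg (ae_of_all _ fun x => ?_) (h_int.comp_measurable (by fun_prop))
    (ae_of_all _ fun x => ?_)
  · exact mul_nonneg (by positivity) (Set.indicator_apply_nonneg fun _ => abs_nonneg x)
  · by_cases h : |x| ∈ Set.Iic D
    · have h_mul : |x| ≤ |σ * x| := by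
        rw [abs_mul, abs_of_nonneg (zero_le_one.trans hσ)]
        exact le_mul_of_one_le_left (abs_nonneg x) hσ
      simp only [Set.indicator_of_mem h, id, one_div_mul_eq_div]
      exact le_min (by gcongr) ((div_le_one hD).2 h)
    · simp only [Set.indicator_of_notMem h, mul_zero]
      positivity

/-- For `X ~ N(0, σ²)` with `σ ≥ 1` and `β` uniform on `[0, D]` independent of `X`,
the probability that `a` and `a + X` hash to the same length-`D` interval under the
shift `β` is at most `1 − (1/D)·√(2/π)·(1 − e^{−D²/2})`; in particular
`E[min(|X|/D, 1)] ≥ (1/D)·√(2/π)·(1 − e^{−D²/2})`, so the collision bound `g` of the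
randomly shifted interval hash remains valid for all `σ ≥ 1`. -/
theorem interval_hash_collision_bound (D σ : ℝ) (hD : 0 < D) (hσ : 1 ≤ σ) (a : ℝ) :
    ((gaussianReal 0 (Real.toNNReal (σ ^ 2))).prod
          ((ENNReal.ofReal D)⁻¹ • volume.restrict (Set.Icc (0 : ℝ) D)))
        {p : ℝ × ℝ | ⌊(a + p.2) / D⌋ = ⌊(a + p.1 + p.2) / D⌋} ≤
      ENNReal.ofReal (1 - (1 / D) * Real.sqrt (2 / Real.pi) * (1 - Real.exp (-(D ^ 2) / 2))) ∧
    (1 / D) * Real.sqrt (2 / Real.pi) * (1 - Real.exp (-(D ^ 2) / 2)) ≤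
      ∫ x, min (|x| / D) 1 ∂(gaussianReal 0 (Real.toNNReal (σ ^ 2))) := by
  have h_moment := le_integral_min_abs_div_one_gaussianReal hD hσ
  refine ⟨?_, h_moment⟩
  set μ := gaussianReal 0 (Real.toNNReal (σ ^ 2))
  have h_meas : MeasurableSet {p : ℝ × ℝ | ⌊(a + p.2) / D⌋ = ⌊(a + p.1 + p.2) / D⌋} :=
    measurableSet_eq_fun (by fun_prop) (by fun_prop)
  have h_int := integrable_min_abs_div_one hD μ
  have h_slice : ∀ x : ℝ, ((ENNReal.ofReal D)⁻¹ • volume.restrict (Set.Icc (0 : ℝ) D))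
      (Prod.mk x ⁻¹' {p : ℝ × ℝ | ⌊(a + p.2) / D⌋ = ⌊(a + p.1 + p.2) / D⌋}) ≤
      ENNReal.ofReal (1 - min (|x| / D) 1) := by
    intro x
    rw [Measure.smul_apply, Measure.restrict_apply (measurable_prodMk_left h_meas), smul_eq_mul]
    refine (mul_le_mul_right (volume_floor_eq_floor_le hD a x) _).trans ?_
    rw [← ENNReal.ofReal_inv_of_pos hD, ← ENNReal.ofReal_mul (by positivity)]
    have h_eq : D⁻¹ * (D - |x|) = 1 - |x| / D := by field_simp
    rw [h_eq]
    rcases le_total (|x| / D) 1 with h | h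
    · rw [min_eq_left h]
    · rw [ENNReal.ofReal_of_nonpos (sub_nonpos.2 h)]
      exact zero_le
  rw [Measure.prod_apply h_meas]
  calc _ ≤ ∫⁻ x, ENNReal.ofReal (1 - min (|x| / D) 1) ∂μ := lintegral_mono h_slice
    _ = ENNReal.ofReal (∫ x, (1 - min (|x| / D) 1) ∂μ) :=
      (ofReal_integral_eq_lintegral_ofReal ((integrable_const 1).sub h_int)
        (ae_of_all _ fun x => sub_nonneg.2 (min_le_right _ _))).symm
    _ ≤ _ := by
      rw [integral_sub (integrable_const 1) h_int]
      refine ENNReal.ofReal_le_ofReal ?_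
      rw [integral_const, probReal_univ, one_smul]
      exact sub_le_sub_left h_moment 1
end
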